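/- arXiv:1707.05825 — 8 statements merged into one kernel-verified Lean document; each statement's English description precedes it below -/
import Mathlib

section
/- Under non-informative linkage and independent Bernoulli clerical sampling, E[(1 − R)·π·(Y* − μ) | σ(X)] = 0 almost surely, where π := E[D | σ(X, Y*)] is the conditional match probability. -/
open MeasureTheory

/-- The σ-algebra `σ(f)` generated by a random element `f`. -/
def sigmaAlg {Ω α : Type*} [m : MeasurableSpace α] (f : Ω → α) : MeasurableSpace Ω :=
  MeasurableSpace.comap f m

/-- Under non-informative linkage and independent Bernoulli clerical sampling,
`E[(1 − R)·π·(Y* − μ) | σ(X)] = 0` almost surely, where `π := E[D | σ(X, Y*)]`. -/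
theorem condexp_unsampled_residual
    {Ω : Type*} [MeasurableSpace Ω] (Pr : Measure Ω) [IsProbabilityMeasure Pr]
    {d : ℕ} (X : Ω → Fin d → ℝ) (Ystar D : Ω → ℝ) (β : Fin d → ℝ)
    (hX : Measurable X) (hY : Measurable Ystar) (hD : Measurable D)
    (hXbd : ∃ C, ∀ ω i, |X ω i| ≤ C)
    (hY01 : ∀ ω, Ystar ω = 0 ∨ Ystar ω = 1)
    (hD01 : ∀ ω, D ω = 0 ∨ D ω = 1)
    (μ : Ω → ℝ)
    (hμ : ∀ ω, μ ω = Real.exp (∑ i, X ω i * β i) / (1 + Real.exp (∑ i, X ω i * β i)))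
    (R : Ω → ℝ) (hR : Measurable R) (hR01 : ∀ ω, R ω = 0 ∨ R ω = 1)
    (p : ℝ) (hp : p ∈ Set.Icc (0 : ℝ) 1)
    (hRp : Pr {ω | R ω = 1} = ENNReal.ofReal p)
    (hRindep : ProbabilityTheory.IndepFun R (fun ω => (X ω, Ystar ω, D ω)) Pr)
    (π : Ω → ℝ)
    (hπ : π =ᵐ[Pr] Pr[D | sigmaAlg fun ω => (X ω, Ystar ω)])
    (hNI : (fun ω => D ω *
        (Pr[fun ω' => Ystar ω' - μ ω' | sigmaAlg fun ω'' => (X ω'', D ω'')]) ω) =ᵐ[Pr] 0)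
    :
    Pr[fun ω => (1 - R ω) * π ω * (Ystar ω - μ ω) | sigmaAlg X] =ᵐ[Pr] 0 := by
  classical
  have hXYm : Measurable fun ω => (X ω, Ystar ω) := hX.prodMk hY
  have hXDm : Measurable fun ω => (X ω, D ω) := hX.prodMk hD
  have hG : (sigmaAlg fun ω => (X ω, Ystar ω)) ≤ ‹MeasurableSpace Ω› := hXYm.comap_le
  have hH : (sigmaAlg fun ω => (X ω, D ω)) ≤ ‹MeasurableSpace Ω› := hXDm.comap_le
  have hXG : sigmaAlg X ≤ sigmaAlg fun ω => (X ω, Ystar ω) := by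
    have h : Measurable[sigmaAlg fun ω => (X ω, Ystar ω)] X :=
      measurable_fst.comp (comap_measurable fun ω => (X ω, Ystar ω))
    exact h.comap_le
  have hXH : sigmaAlg X ≤ sigmaAlg fun ω => (X ω, D ω) := by
    have h : Measurable[sigmaAlg fun ω => (X ω, D ω)] X :=
      measurable_fst.comp (comap_measurable fun ω => (X ω, D ω))
    exact h.comap_le
  have hmeas : Measurable fun q : (Fin d → ℝ) × ℝ => q.2 -
      Real.exp (∑ i, q.1 i * β i) / (1 + Real.exp (∑ i, q.1 i * β i)) := by fun_prop
  have hresG : Measurable[sigmaAlg fun ω => (X ω, Ystar ω)] fun ω => Ystar ω - μ ω := by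
    have h := hmeas.comp (comap_measurable fun ω => (X ω, Ystar ω))
    have e : (fun ω => Ystar ω - μ ω) = (fun q : (Fin d → ℝ) × ℝ => q.2 -
      Real.exp (∑ i, q.1 i * β i) / (1 + Real.exp (∑ i, q.1 i * β i))) ∘
        (fun ω => (X ω, Ystar ω)) := by
      funext ω; simp [hμ]
    rw [e]; exact h
  have hres : Measurable fun ω => Ystar ω - μ ω := hresG.mono hG le_rfl
  have hbd : ∀ ω, ‖Ystar ω - μ ω‖ ≤ 1 := by
    intro ω
    have h0 : 0 ≤ μ ω := by rw [hμ]; positivity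
    have h1 : μ ω ≤ 1 := by
      rw [hμ, div_le_one (by positivity)]; linarith
    rw [Real.norm_eq_abs, abs_le]
    rcases hY01 ω with h | h <;> rw [h] <;> constructor <;> linarith
  have hDbd : ∀ ω, ‖D ω‖ ≤ 1 := by
    intro ω; rcases hD01 ω with h | h <;> simp [h]
  have hRbd : ∀ ω, ‖1 - R ω‖ ≤ 1 := by
    intro ω; rcases hR01 ω with h | h <;> simp [h]
  have hDi : Integrable D Pr :=
    Integrable.of_bound hD.aestronglyMeasurable 1 (.of_forall hDbd)
  have hri : Integrable (fun ω => Ystar ω - μ ω) Pr :=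
    Integrable.of_bound hres.aestronglyMeasurable 1 (.of_forall hbd)
  have hRm : Measurable fun ω => 1 - R ω := measurable_const.sub hR
  have hRi : Integrable (fun ω => 1 - R ω) Pr :=
    Integrable.of_bound hRm.aestronglyMeasurable 1 (.of_forall hRbd)
  have hDr : Integrable (D * fun ω => Ystar ω - μ ω) Pr :=
    hri.bdd_mul hD.aestronglyMeasurable (.of_forall hDbd)
  -- the residual among matched records has conditional mean zero given `X`
  have hDH : Measurable[sigmaAlg fun ω => (X ω, D ω)] D :=
    measurable_snd.comp (comap_measurable fun ω => (X ω, D ω))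
  have s1 : Pr[D * (fun ω => Ystar ω - μ ω) | sigmaAlg fun ω => (X ω, D ω)] =ᵐ[Pr] 0 :=
    (condExp_mul_of_stronglyMeasurable_left hDH.stronglyMeasurable hDr hri).trans hNI
  have s2 : Pr[D * (fun ω => Ystar ω - μ ω) | sigmaAlg X] =ᵐ[Pr] 0 := by
    refine (condExp_condExp_of_le hXH hH).symm.trans ((condExp_congr_ae s1).trans ?_)
    rw [condExp_zero]
  -- `g = π₀ (Y* - μ)` is the projection of `D (Y* - μ)`
  have s3 : Pr[D * (fun ω => Ystar ω - μ ω) | sigmaAlg fun ω => (X ω, Ystar ω)] =ᵐ[Pr]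
      Pr[D | sigmaAlg fun ω => (X ω, Ystar ω)] * fun ω => Ystar ω - μ ω :=
    condExp_mul_of_stronglyMeasurable_right hresG.stronglyMeasurable hDr hDi
  have s4 : Pr[Pr[D | sigmaAlg fun ω => (X ω, Ystar ω)] * (fun ω => Ystar ω - μ ω) |
      sigmaAlg X] =ᵐ[Pr] 0 :=
    (condExp_congr_ae s3.symm).trans ((condExp_condExp_of_le hXG hG).trans s2)
  set g : Ω → ℝ := Pr[D | sigmaAlg fun ω => (X ω, Ystar ω)] * (fun ω => Ystar ω - μ ω) with hg
  have hgm : StronglyMeasurable[sigmaAlg fun ω => (X ω, Ystar ω)] g :=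
    stronglyMeasurable_condExp.mul hresG.stronglyMeasurable
  have hgi : Integrable g Pr :=
    (integrable_condExp (m := sigmaAlg fun ω => (X ω, Ystar ω))).mul_bdd
      hres.aestronglyMeasurable (.of_forall hbd)
  have hRgi : Integrable ((fun ω => 1 - R ω) * g) Pr :=
    hgi.bdd_mul hRm.aestronglyMeasurable (.of_forall hRbd)
  have hind : ProbabilityTheory.Indep (sigmaAlg R) (sigmaAlg fun ω => (X ω, Ystar ω)) Pr := by
    have h : ProbabilityTheory.IndepFun R (fun ω => (X ω, Ystar ω)) Pr :=
      hRindep.comp (φ := id) (ψ := fun q : (Fin d → ℝ) × ℝ × ℝ => (q.1, q.2.1))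
        measurable_id (by fun_prop)
    exact (ProbabilityTheory.IndepFun_iff_Indep _ _ _).1 h
  have hRR : Measurable[sigmaAlg R] fun ω => 1 - R ω :=
    (measurable_const.sub measurable_id : Measurable fun x : ℝ => 1 - x).comp
      (comap_measurable R)
  have s5 : Pr[fun ω => 1 - R ω | sigmaAlg fun ω => (X ω, Ystar ω)] =ᵐ[Pr]
      fun _ => ∫ ω, (1 - R ω) ∂Pr :=
    condExp_indep_eq hR.comap_le hG hRR.stronglyMeasurable hind
  have s6 : Pr[(fun ω => 1 - R ω) * g | sigmaAlg fun ω => (X ω, Ystar ω)] =ᵐ[Pr]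
      (∫ ω, (1 - R ω) ∂Pr) • g := by
    refine (condExp_mul_of_stronglyMeasurable_right hgm hRgi hRi).trans ?_
    filter_upwards [s5] with ω h
    simp [h]
  have s7 : (fun ω => (1 - R ω) * π ω * (Ystar ω - μ ω)) =ᵐ[Pr] (fun ω => 1 - R ω) * g := by
    filter_upwards [hπ] with ω h
    simp [hg, h, mul_assoc]
  refine (condExp_congr_ae s7).trans ((condExp_condExp_of_le hXG hG).symm.trans
    ((condExp_congr_ae s6).trans ((condExp_smul _ _ _).trans ?_)))
  filter_upwards [s4] with ω h
  simp [h]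
end

section
/- (Unbiasedness of the estimating function.) Under non-informative linkage and independent Bernoulli clerical sampling, the estimating function term H := (R·D + (1 − R)·π)·(Y* − μ) satisfies E[H | σ(X)] = 0 almost surely; consequently E[X·H] = 0. -/
open MeasureTheory

theorem integral_mul_condExp_aux {Ω : Type*} {mm m0 : MeasurableSpace Ω} (hle : mm ≤ m0)
    (P : @Measure Ω m0) [IsProbabilityMeasure P] (f h : Ω → ℝ)
    (hf : StronglyMeasurable[mm] f) (hfh : Integrable (fun ω => f ω * h ω) P)
    (hh : Integrable h P) :
    ∫ ω, f ω * h ω ∂P = ∫ ω, f ω * (P[h | mm]) ω ∂P := by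
  have h1 := condExp_mul_of_stronglyMeasurable_left (μ := P) hf hfh hh
  rw [← integral_condExp (μ := P) hle (f := fun ω => f ω * h ω)]
  exact integral_congr_ae h1

/-- Unbiasedness of the estimating function: under non-informative linkage and independent
Bernoulli clerical sampling, `H := (R·D + (1 − R)·π)·(Y* − μ)` satisfies `E[H | σ(X)] = 0`
almost surely; consequently `E[X·H] = 0`. -/
theorem estimating_function_unbiased
    {Ω : Type*} [MeasurableSpace Ω] (Pr : Measure Ω) [IsProbabilityMeasure Pr]
    {d : ℕ} (X : Ω → Fin d → ℝ) (Ystar D : Ω → ℝ) (β : Fin d → ℝ)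
    (hX : Measurable X) (hY : Measurable Ystar) (hD : Measurable D)
    (hXbd : ∃ C, ∀ ω i, |X ω i| ≤ C)
    (hY01 : ∀ ω, Ystar ω = 0 ∨ Ystar ω = 1)
    (hD01 : ∀ ω, D ω = 0 ∨ D ω = 1)
    (μ : Ω → ℝ)
    (hμ : ∀ ω, μ ω = Real.exp (∑ i, X ω i * β i) / (1 + Real.exp (∑ i, X ω i * β i)))
    (R : Ω → ℝ) (hR : Measurable R) (hR01 : ∀ ω, R ω = 0 ∨ R ω = 1)
    (p : ℝ) (hp : p ∈ Set.Icc (0 : ℝ) 1)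
    (hRp : Pr {ω | R ω = 1} = ENNReal.ofReal p)
    (hRindep : ProbabilityTheory.IndepFun R (fun ω => (X ω, Ystar ω, D ω)) Pr)
    (π : Ω → ℝ)
    (hπ : π =ᵐ[Pr] Pr[D | sigmaAlg fun ω => (X ω, Ystar ω)])
    (hNI : (fun ω => D ω *
        (Pr[fun ω' => Ystar ω' - μ ω' | sigmaAlg fun ω'' => (X ω'', D ω'')]) ω) =ᵐ[Pr] 0)
    (H : Ω → ℝ)
    (hH : ∀ ω, H ω = (R ω * D ω + (1 - R ω) * π ω) * (Ystar ω - μ ω))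
    :
    Pr[H | sigmaAlg X] =ᵐ[Pr] 0 ∧ ∀ i, ∫ ω, X ω i * H ω ∂Pr = 0 := by
  have hpX : Measurable[sigmaAlg X] X := comap_measurable X
  have hpXY : Measurable[sigmaAlg fun ω => (X ω, Ystar ω)] (fun ω => (X ω, Ystar ω)) :=
    comap_measurable _
  have hpXD : Measurable[sigmaAlg fun ω => (X ω, D ω)] (fun ω => (X ω, D ω)) :=
    comap_measurable _
  have hpT : Measurable[sigmaAlg fun ω => (X ω, Ystar ω, D ω)] (fun ω => (X ω, Ystar ω, D ω)) :=
    comap_measurable _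
  have leX : sigmaAlg X ≤ ‹MeasurableSpace Ω› := hX.comap_le
  have leXY : sigmaAlg (fun ω => (X ω, Ystar ω)) ≤ ‹MeasurableSpace Ω› :=
    (hX.prodMk hY).comap_le
  have leXD : sigmaAlg (fun ω => (X ω, D ω)) ≤ ‹MeasurableSpace Ω› :=
    (hX.prodMk hD).comap_le
  have leT : sigmaAlg (fun ω => (X ω, Ystar ω, D ω)) ≤ ‹MeasurableSpace Ω› :=
    (hX.prodMk (hY.prodMk hD)).comap_le
  have X_XY : sigmaAlg X ≤ sigmaAlg (fun ω => (X ω, Ystar ω)) :=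
    (measurable_fst.comp hpXY).comap_le
  have X_XD : sigmaAlg X ≤ sigmaAlg (fun ω => (X ω, D ω)) :=
    (measurable_fst.comp hpXD).comap_le
  have XY_T : sigmaAlg (fun ω => (X ω, Ystar ω)) ≤ sigmaAlg (fun ω => (X ω, Ystar ω, D ω)) :=
    ((measurable_fst.comp hpT).prodMk
      ((measurable_fst.comp measurable_snd).comp hpT)).comap_le
  have DT : Measurable[sigmaAlg fun ω => (X ω, Ystar ω, D ω)] D :=
    (measurable_snd.comp measurable_snd).comp hpT
  have DXD : Measurable[sigmaAlg fun ω => (X ω, D ω)] D := measurable_snd.comp hpXD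
  have YXY : Measurable[sigmaAlg fun ω => (X ω, Ystar ω)] Ystar := measurable_snd.comp hpXY
  have μX : Measurable[sigmaAlg X] μ := by
    have h0 : Measurable (fun x : Fin d → ℝ =>
        Real.exp (∑ i, x i * β i) / (1 + Real.exp (∑ i, x i * β i))) := by fun_prop
    have : μ = (fun x : Fin d → ℝ =>
        Real.exp (∑ i, x i * β i) / (1 + Real.exp (∑ i, x i * β i))) ∘ X := by
      funext ω; exact hμ ω
    rw [this]
    exact h0.comp hpX
  let Z : Ω → ℝ := fun ω => Ystar ω - μ ω
  have ZXY : Measurable[sigmaAlg fun ω => (X ω, Ystar ω)] Z := YXY.sub (μX.mono X_XY le_rfl)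
  have Zm : Measurable Z := ZXY.mono leXY le_rfl
  have Zb : ∀ ω, |Z ω| ≤ 1 := by
    intro ω
    have e := Real.exp_pos (∑ i, X ω i * β i)
    have h0 : 0 ≤ μ ω := by rw [hμ]; positivity
    have h1 : μ ω ≤ 1 := by rw [hμ, div_le_one (by positivity)]; linarith
    rw [abs_le]
    rcases hY01 ω with h | h <;> simp only [Z, h] <;> constructor <;> linarith
  have Db : ∀ ω, |D ω| ≤ 1 := by
    intro ω; rcases hD01 ω with h | h <;> simp [h]
  have Rb : ∀ ω, |R ω| ≤ 1 := by
    intro ω; rcases hR01 ω with h | h <;> simp [h]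
  have Rb' : ∀ ω, |1 - R ω| ≤ 1 := by
    intro ω; rcases hR01 ω with h | h <;> simp [h]
  have Zi : Integrable Z Pr := Integrable.of_bound Zm.aestronglyMeasurable 1 (ae_of_all _ Zb)
  have Di : Integrable D Pr := Integrable.of_bound hD.aestronglyMeasurable 1 (ae_of_all _ Db)
  let q : Ω → ℝ := Pr[D | sigmaAlg fun ω => (X ω, Ystar ω)]
  have qi : Integrable q Pr := integrable_condExp
  have qm : Measurable[sigmaAlg fun ω => (X ω, Ystar ω)] q :=
    stronglyMeasurable_condExp.measurable
  have indep : ∀ f : Ω → ℝ, Measurable[sigmaAlg fun ω => (X ω, Ystar ω, D ω)] f →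
      ProbabilityTheory.IndepFun R f Pr := by
    intro f hf
    rw [ProbabilityTheory.IndepFun_iff_Indep] at hRindep ⊢
    exact ProbabilityTheory.indep_of_indep_of_le_right hRindep hf.comap_le
  have key : ∀ g : Ω → ℝ, Measurable[sigmaAlg X] g → (∃ C, ∀ ω, |g ω| ≤ C) →
      Integrable (fun ω => g ω * H ω) Pr ∧ ∫ ω, g ω * H ω ∂Pr = 0 := by
    rintro g hg ⟨C, hC⟩
    have gm : Measurable g := hg.mono leX le_rfl
    have gDb : ∀ ω, |g ω * D ω| ≤ C := by
      intro ω; rw [abs_mul]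
      nlinarith [abs_nonneg (g ω), abs_nonneg (D ω), Db ω, hC ω]
    have gZb : ∀ ω, |g ω * Z ω| ≤ C := by
      intro ω; rw [abs_mul]
      nlinarith [abs_nonneg (g ω), abs_nonneg (Z ω), Zb ω, hC ω]
    have iA : Integrable (fun ω => (g ω * D ω) * Z ω) Pr :=
      Zi.bdd_mul (gm.mul hD).aestronglyMeasurable (ae_of_all _ gDb)
    have iA' : Integrable (fun ω => (g ω * Z ω) * D ω) Pr :=
      Di.bdd_mul (gm.mul Zm).aestronglyMeasurable (ae_of_all _ gZb)
    have iB : Integrable (fun ω => (g ω * Z ω) * q ω) Pr :=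
      qi.bdd_mul (gm.mul Zm).aestronglyMeasurable (ae_of_all _ gZb)
    have eA : ∫ ω, (g ω * D ω) * Z ω ∂Pr = 0 := by
      rw [integral_mul_condExp_aux leXD Pr (fun ω => g ω * D ω) Z
        ((hg.mono X_XD le_rfl).mul DXD).stronglyMeasurable iA Zi]
      apply integral_eq_zero_of_ae
      filter_upwards [hNI] with ω h
      have h' : D ω * (Pr[Z | sigmaAlg fun ω'' => (X ω'', D ω'')]) ω = 0 := h
      simp only [Pi.zero_apply]
      rw [mul_assoc, h', mul_zero]
    have eB : ∫ ω, (g ω * Z ω) * q ω ∂Pr = 0 := by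
      rw [← integral_mul_condExp_aux leXY Pr (fun ω => g ω * Z ω) D
        ((hg.mono X_XY le_rfl).mul ZXY).stronglyMeasurable iA' Di, ← eA]
      congr 1; funext ω; ring
    have mA : Measurable[sigmaAlg fun ω => (X ω, Ystar ω, D ω)]
        (fun ω => (g ω * D ω) * Z ω) :=
      ((hg.mono (X_XY.trans XY_T) le_rfl).mul DT).mul (ZXY.mono XY_T le_rfl)
    have mB : Measurable[sigmaAlg fun ω => (X ω, Ystar ω, D ω)]
        (fun ω => (g ω * Z ω) * q ω) :=
      ((hg.mono (X_XY.trans XY_T) le_rfl).mul (ZXY.mono XY_T le_rfl)).mul (qm.mono XY_T le_rfl)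
    have iRA : Integrable (fun ω => R ω * ((g ω * D ω) * Z ω)) Pr :=
      iA.bdd_mul hR.aestronglyMeasurable (ae_of_all _ Rb)
    have iRB : Integrable (fun ω => R ω * ((g ω * Z ω) * q ω)) Pr :=
      iB.bdd_mul hR.aestronglyMeasurable (ae_of_all _ Rb)
    have eRA : ∫ ω, R ω * ((g ω * D ω) * Z ω) ∂Pr = 0 := by
      rw [(indep _ mA).integral_fun_mul_eq_mul_integral hR.aestronglyMeasurable
        iA.aestronglyMeasurable, eA, mul_zero]
    have eRB : ∫ ω, R ω * ((g ω * Z ω) * q ω) ∂Pr = 0 := by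
      rw [(indep _ mB).integral_fun_mul_eq_mul_integral hR.aestronglyMeasurable
        iB.aestronglyMeasurable, eB, mul_zero]
    have heq : (fun ω => g ω * H ω) =ᵐ[Pr] fun ω => R ω * ((g ω * D ω) * Z ω) +
        ((g ω * Z ω) * q ω - R ω * ((g ω * Z ω) * q ω)) := by
      filter_upwards [hπ] with ω h
      have h' : π ω = q ω := h
      simp only [hH, h', Z]
      ring
    refine ⟨(iRA.add (iB.sub iRB)).congr heq.symm, ?_⟩
    have iS : Integrable (fun ω => (g ω * Z ω) * q ω - R ω * ((g ω * Z ω) * q ω)) Pr :=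
      iB.sub iRB
    rw [integral_congr_ae heq, integral_add iRA iS, integral_sub iB iRB, eRA, eRB, eB]
    simp
  refine ⟨?_, fun i => ?_⟩
  · have Hi : Integrable H Pr := by
      have := (key (fun _ => 1) measurable_const ⟨1, by simp⟩).1
      simpa using this
    symm
    refine ae_eq_condExp_of_forall_setIntegral_eq leX Hi
      (fun s _ _ => (integrable_zero _ _ _).integrableOn) ?_ aestronglyMeasurable_zero
    intro s hs _
    have h := (key (s.indicator fun _ => 1) (measurable_const.indicator hs) ⟨1, fun ω => by
      by_cases h : ω ∈ s <;> simp [h]⟩).2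
    rw [← integral_indicator (leX s hs) (f := H)]
    simp only [Pi.zero_apply, integral_zero]
    rw [← h]
    congr 1; funext ω
    by_cases h : ω ∈ s <;> simp [h]
  · obtain ⟨C, hC⟩ := hXbd
    exact (key (fun ω => X ω i) ((measurable_pi_apply i).comp hpX) ⟨C, fun ω => hC ω i⟩).2
end

section
/- Under non-informative linkage and independent Bernoulli clerical sampling, E[H | σ(X) ∨ σ(R)] = 0 almost surely, where H := (R·D + (1 − R)·π)·(Y* − μ); that is, the estimating function term is conditionally centered given the covariates and the sample-selection indicator. -/
open MeasureTheory

/-- If `f` is measurable w.r.t. `mG`, which contains `σ(X)` and is independent of `σ(R)`, and `f` is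
conditionally centered given `X`, it is conditionally centered given `X` and `R`. -/
theorem condExp_sup_zero_aux {Ω α γ : Type*} {mG : MeasurableSpace Ω} {m0 : MeasurableSpace Ω}
    [mα : MeasurableSpace α] [mγ : MeasurableSpace γ]
    (Pr : Measure Ω) [IsProbabilityMeasure Pr] (X : Ω → α) (R : Ω → γ)
    (hX : Measurable X) (hR : Measurable R) (hG : mG ≤ m0)
    (hXG : MeasurableSpace.comap X mα ≤ mG)
    (hind : ProbabilityTheory.Indep mG (MeasurableSpace.comap R mγ) Pr)
    (f : Ω → ℝ) (hf : StronglyMeasurable[mG] f) (hfi : Integrable f Pr)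
    (h0 : Pr[f | MeasurableSpace.comap X mα] =ᵐ[Pr] 0) :
    Pr[f | MeasurableSpace.comap X mα ⊔ MeasurableSpace.comap R mγ] =ᵐ[Pr] 0 := by
  have hle : MeasurableSpace.comap X mα ⊔ MeasurableSpace.comap R mγ ≤ m0 :=
    sup_le hX.comap_le hR.comap_le
  have hcomap : MeasurableSpace.comap X mα ⊔ MeasurableSpace.comap R mγ
      = MeasurableSpace.comap (fun ω => (X ω, R ω)) Prod.instMeasurableSpace := by
    rw [Prod.instMeasurableSpace, MeasurableSpace.prod, MeasurableSpace.comap_sup, MeasurableSpace.comap_comp,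
      MeasurableSpace.comap_comp]
    rfl
  have hXR : Measurable (fun ω => (X ω, R ω)) := hX.prodMk hR
  have hint : ∫ x, f x ∂Pr = 0 := by
    rw [← integral_condExp hX.comap_le, integral_congr_ae h0]; simp
  have key : ∀ T : Set (α × γ), MeasurableSet T →
      ∫ x in (fun ω => (X ω, R ω)) ⁻¹' T, f x ∂Pr = 0 := by
    intro T hT
    induction T, hT using MeasurableSpace.induction_on_inter generateFrom_prod.symm
      isPiSystem_prod with
    | empty => simp
    | basic T hT =>
      obtain ⟨s, hs, t, ht, rfl⟩ := hT
      have hs' : MeasurableSet[MeasurableSpace.comap X mα] (X ⁻¹' s) := ⟨s, hs, rfl⟩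
      have ht' : MeasurableSet[MeasurableSpace.comap R mγ] (R ⁻¹' t) := ⟨t, ht, rfl⟩
      have e : (fun ω => (X ω, R ω)) ⁻¹' (s ×ˢ t) = R ⁻¹' t ∩ X ⁻¹' s := by
        ext ω; simp [and_comm]
      have h1 := condExp_indep_eq (f := (X ⁻¹' s).indicator f) hG hR.comap_le
        (hf.indicator (hXG _ hs')) hind
      have h2 : ∫ x, (X ⁻¹' s).indicator f x ∂Pr = 0 := by
        rw [integral_indicator (hX hs), ← setIntegral_condExp hX.comap_le hfi hs',
          setIntegral_congr_ae (g := fun _ => (0:ℝ)) (hX hs)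
            (by filter_upwards [h0] with x hx _ using hx)]
        simp
      simp only [e]
      rw [← setIntegral_indicator (hX hs),
        ← setIntegral_condExp hR.comap_le (hfi.indicator (hX hs)) ht',
        setIntegral_congr_ae (g := fun _ => (0:ℝ)) (hR ht)
          (by filter_upwards [h1] with x hx _ using by rw [hx, h2])]
      simp
    | compl T hT ih =>
      have := integral_add_compl (hXR hT) hfi
      rw [ih, hint, zero_add] at this
      exact this
    | iUnion T hd hT ih =>
      rw [Set.preimage_iUnion, integral_iUnion (fun i => hXR (hT i))
        (fun i j hij => (hd hij).preimage _) hfi.integrableOn]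
      simp [ih]
  refine (ae_eq_condExp_of_forall_setIntegral_eq hle hfi (fun s _ _ => ?_) ?_ ?_).symm
  · exact (integrable_zero _ _ _).integrableOn
  · intro s hs _
    rw [hcomap] at hs
    obtain ⟨T, hT, rfl⟩ := hs
    rw [key T hT]; simp
  · exact stronglyMeasurable_zero.aestronglyMeasurable

/-- Under non-informative linkage and independent Bernoulli clerical sampling,
`E[H | σ(X) ∨ σ(R)] = 0` almost surely for `H := (R·D + (1 − R)·π)·(Y* − μ)`. -/
theorem condexp_H_given_X_and_R
    {Ω : Type*} [MeasurableSpace Ω] (Pr : Measure Ω) [IsProbabilityMeasure Pr]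
    {d : ℕ} (X : Ω → Fin d → ℝ) (Ystar D : Ω → ℝ) (β : Fin d → ℝ)
    (hX : Measurable X) (hY : Measurable Ystar) (hD : Measurable D)
    (hXbd : ∃ C, ∀ ω i, |X ω i| ≤ C)
    (hY01 : ∀ ω, Ystar ω = 0 ∨ Ystar ω = 1)
    (hD01 : ∀ ω, D ω = 0 ∨ D ω = 1)
    (μ : Ω → ℝ)
    (hμ : ∀ ω, μ ω = Real.exp (∑ i, X ω i * β i) / (1 + Real.exp (∑ i, X ω i * β i)))
    (R : Ω → ℝ) (hR : Measurable R) (hR01 : ∀ ω, R ω = 0 ∨ R ω = 1)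
    (p : ℝ) (hp : p ∈ Set.Icc (0 : ℝ) 1)
    (hRp : Pr {ω | R ω = 1} = ENNReal.ofReal p)
    (hRindep : ProbabilityTheory.IndepFun R (fun ω => (X ω, Ystar ω, D ω)) Pr)
    (π : Ω → ℝ)
    (hπ : π =ᵐ[Pr] Pr[D | sigmaAlg fun ω => (X ω, Ystar ω)])
    (hNI : (fun ω => D ω *
        (Pr[fun ω' => Ystar ω' - μ ω' | sigmaAlg fun ω'' => (X ω'', D ω'')]) ω) =ᵐ[Pr] 0)
    (H : Ω → ℝ)
    (hH : ∀ ω, H ω = (R ω * D ω + (1 - R ω) * π ω) * (Ystar ω - μ ω))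
    :
    Pr[H | sigmaAlg X ⊔ sigmaAlg R] =ᵐ[Pr] 0 := by
  have hmXY : sigmaAlg (fun ω => (X ω, Ystar ω)) ≤ ‹MeasurableSpace Ω› := (hX.prodMk hY).comap_le
  have hmXD : sigmaAlg (fun ω => (X ω, D ω)) ≤ ‹MeasurableSpace Ω› := (hX.prodMk hD).comap_le
  have hmG : sigmaAlg (fun ω => (X ω, Ystar ω, D ω)) ≤ ‹MeasurableSpace Ω› :=
    (hX.prodMk (hY.prodMk hD)).comap_le
  have hmX : sigmaAlg X ≤ ‹MeasurableSpace Ω› := hX.comap_le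
  have hmR : sigmaAlg R ≤ ‹MeasurableSpace Ω› := hR.comap_le
  have hX_XY : sigmaAlg X ≤ sigmaAlg (fun ω => (X ω, Ystar ω)) :=
    (measurable_fst.comp (comap_measurable (fun ω => (X ω, Ystar ω)))).comap_le
  have hX_XD : sigmaAlg X ≤ sigmaAlg (fun ω => (X ω, D ω)) :=
    (measurable_fst.comp (comap_measurable (fun ω => (X ω, D ω)))).comap_le
  have hXY_G : sigmaAlg (fun ω => (X ω, Ystar ω)) ≤
      sigmaAlg (fun ω => (X ω, Ystar ω, D ω)) :=
    ((measurable_fst.prodMk (measurable_fst.comp measurable_snd)).comp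
      (comap_measurable (fun ω => (X ω, Ystar ω, D ω)))).comap_le
  -- the residual
  have hmuf : Measurable (fun x : Fin d → ℝ =>
      Real.exp (∑ i, x i * β i) / (1 + Real.exp (∑ i, x i * β i))) := by fun_prop
  obtain ⟨e, he⟩ : ∃ e : Ω → ℝ, e = fun ω => Ystar ω - μ ω := ⟨_, rfl⟩
  have heq : e = (fun q : (Fin d → ℝ) × ℝ => q.2 -
      Real.exp (∑ i, q.1 i * β i) / (1 + Real.exp (∑ i, q.1 i * β i))) ∘
      (fun ω => (X ω, Ystar ω)) := by
    rw [he]; funext ω; simp [hμ]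
  have heXY : Measurable[sigmaAlg (fun ω => (X ω, Ystar ω))] e := by
    rw [heq]
    exact (measurable_snd.sub (hmuf.comp measurable_fst)).comp (comap_measurable _)
  have hem : Measurable e := heXY.mono hmXY le_rfl
  have hebd : ∀ ω, ‖e ω‖ ≤ 1 := by
    intro ω
    have hpos := Real.exp_pos (∑ i, X ω i * β i)
    have h0 : 0 ≤ μ ω := by rw [hμ]; positivity
    have h1 : μ ω ≤ 1 := by rw [hμ, div_le_one (by positivity)]; linarith
    rw [he, Real.norm_eq_abs, abs_le]
    rcases hY01 ω with h | h <;> simp only [h] <;> constructor <;> linarith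
  have hDbd : ∀ ω, ‖D ω‖ ≤ 1 := by
    intro ω; rcases hD01 ω with h | h <;> simp [h]
  have hRbd : ∀ ω, ‖R ω‖ ≤ 1 := by
    intro ω; rcases hR01 ω with h | h <;> simp [h]
  have hRbd' : ∀ ω, ‖(1 - R) ω‖ ≤ 1 := by
    intro ω; rcases hR01 ω with h | h <;> simp [h]
  have hei : Integrable e Pr :=
    Integrable.of_bound hem.aestronglyMeasurable 1 (.of_forall hebd)
  have hDi : Integrable D Pr :=
    Integrable.of_bound hD.aestronglyMeasurable 1 (.of_forall hDbd)
  have hDe : Integrable (D * e) Pr :=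
    hei.bdd_mul hD.aestronglyMeasurable (.of_forall hDbd)
  obtain ⟨q, hq⟩ : ∃ q : Ω → ℝ, q = Pr[D | sigmaAlg fun ω => (X ω, Ystar ω)] := ⟨_, rfl⟩
  have hqe : Integrable (q * e) Pr := by
    rw [hq]
    exact integrable_condExp.mul_bdd hem.aestronglyMeasurable (.of_forall hebd)
  have hqm : StronglyMeasurable[sigmaAlg fun ω => (X ω, Ystar ω)] q := by
    rw [hq]; exact stronglyMeasurable_condExp
  have hDXD : StronglyMeasurable[sigmaAlg fun ω => (X ω, D ω)] D :=
    (measurable_snd.comp (comap_measurable (fun ω => (X ω, D ω)))).stronglyMeasurable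
  have hDG : StronglyMeasurable[sigmaAlg fun ω => (X ω, Ystar ω, D ω)] D :=
    ((measurable_snd.comp measurable_snd).comp
      (comap_measurable (fun ω => (X ω, Ystar ω, D ω)))).stronglyMeasurable
  have heG : StronglyMeasurable[sigmaAlg fun ω => (X ω, Ystar ω, D ω)] e :=
    heXY.stronglyMeasurable.mono hXY_G
  -- conditional centering given X
  have hA : Pr[D * e | sigmaAlg X] =ᵐ[Pr] 0 := by
    have h1 : Pr[D * e | sigmaAlg fun ω => (X ω, D ω)] =ᵐ[Pr] 0 := by
      refine (condExp_mul_of_stronglyMeasurable_left hDXD hDe hei).trans ?_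
      rw [he]; exact hNI
    refine (condExp_condExp_of_le hX_XD hmXD).symm.trans ?_
    refine (condExp_congr_ae h1).trans ?_
    rw [condExp_zero]
  have hB : Pr[q * e | sigmaAlg X] =ᵐ[Pr] 0 := by
    have h1 : Pr[D * e | sigmaAlg fun ω => (X ω, Ystar ω)] =ᵐ[Pr] q * e := by
      rw [hq]
      exact condExp_mul_of_stronglyMeasurable_right heXY.stronglyMeasurable hDe hDi
    refine (condExp_congr_ae h1.symm).trans ?_
    exact (condExp_condExp_of_le hX_XY hmXY).trans hA
  have hind : ProbabilityTheory.Indep (sigmaAlg (fun ω => (X ω, Ystar ω, D ω))) (sigmaAlg R) Pr :=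
    ((ProbabilityTheory.IndepFun_iff_Indep _ _ _).1 hRindep).symm
  have hA' : Pr[D * e | sigmaAlg X ⊔ sigmaAlg R] =ᵐ[Pr] 0 :=
    condExp_sup_zero_aux Pr X R hX hR hmG (hX_XY.trans hXY_G) hind _ (hDG.mul heG) hDe hA
  have hB' : Pr[q * e | sigmaAlg X ⊔ sigmaAlg R] =ᵐ[Pr] 0 :=
    condExp_sup_zero_aux Pr X R hX hR hmG (hX_XY.trans hXY_G) hind _
      ((hqm.mono hXY_G).mul heG) hqe hB
  have hRm : StronglyMeasurable[sigmaAlg X ⊔ sigmaAlg R] R :=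
    StronglyMeasurable.mono (m' := sigmaAlg R)
      (comap_measurable R).stronglyMeasurable le_sup_right
  have hRm' : StronglyMeasurable[sigmaAlg X ⊔ sigmaAlg R] (1 - R) :=
    stronglyMeasurable_one.sub hRm
  have hRA : Integrable (R * (D * e)) Pr :=
    hDe.bdd_mul hR.aestronglyMeasurable (.of_forall hRbd)
  have hRB : Integrable ((1 - R) * (q * e)) Pr :=
    hqe.bdd_mul (measurable_one.sub hR).aestronglyMeasurable (.of_forall hRbd')
  have hHe : H =ᵐ[Pr] R * (D * e) + (1 - R) * (q * e) := by
    filter_upwards [hπ] with ω hω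
    rw [← hq] at hω
    simp only [hH, hω, he, Pi.add_apply, Pi.mul_apply, Pi.sub_apply, Pi.one_apply]
    ring
  refine (condExp_congr_ae hHe).trans ((condExp_add hRA hRB _).trans ?_)
  filter_upwards [condExp_mul_of_stronglyMeasurable_left hRm hRA hDe,
    condExp_mul_of_stronglyMeasurable_left hRm' hRB hqe, hA', hB'] with ω h1 h2 h3 h4
  simp [h1, h2, h3, h4]
end

section
/- (Second moment of the score of Chipperfield et al.) Under non-informative linkage and independent Bernoulli clerical sampling, with S̃ := X·H and H := (R·D + (1 − R)·π)·(Y* − μ), one has E[S̃ S̃ᵀ] = p·E[P(D=1|X)·μ·(1−μ)·X Xᵀ] + (1 − p)·E[π²·(Y* − μ)²·X Xᵀ], where P(D=1|X) := E[D | σ(X)]. -/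
open MeasureTheory

/-- Almost everywhere bounded and measurable real functions. -/
def Bd {Ω : Type*} [MeasurableSpace Ω] (P : Measure Ω) (f : Ω → ℝ) : Prop :=
  AEStronglyMeasurable f P ∧ ∃ C, ∀ᵐ ω ∂P, |f ω| ≤ C

theorem Bd.mul {Ω : Type*} [MeasurableSpace Ω] {P : Measure Ω} {f g : Ω → ℝ}
    (hf : Bd P f) (hg : Bd P g) : Bd P (fun ω => f ω * g ω) := by
  obtain ⟨hf, C, hC⟩ := hf
  obtain ⟨hg, K, hK⟩ := hg
  refine ⟨hf.mul hg, C * K, ?_⟩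
  filter_upwards [hC, hK] with ω h1 h2
  rw [abs_mul]
  exact mul_le_mul h1 h2 (abs_nonneg _) ((abs_nonneg _).trans h1)

theorem Bd.sub {Ω : Type*} [MeasurableSpace Ω] {P : Measure Ω} {f g : Ω → ℝ}
    (hf : Bd P f) (hg : Bd P g) : Bd P (fun ω => f ω - g ω) := by
  obtain ⟨hf, C, hC⟩ := hf
  obtain ⟨hg, K, hK⟩ := hg
  refine ⟨hf.sub hg, C + K, ?_⟩
  filter_upwards [hC, hK] with ω h1 h2
  exact (abs_sub _ _).trans (add_le_add h1 h2)

theorem Bd.const {Ω : Type*} [MeasurableSpace Ω] {P : Measure Ω} (c : ℝ) :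
    Bd P (fun _ => c) := ⟨aestronglyMeasurable_const, |c|, by simp⟩

theorem Bd.integrable {Ω : Type*} [MeasurableSpace Ω] {P : Measure Ω} [IsFiniteMeasure P]
    {f : Ω → ℝ} (hf : Bd P f) : Integrable f P := by
  obtain ⟨hf, C, hC⟩ := hf
  exact Integrable.of_bound hf C hC

theorem pull_out {Ω α : Type*} [MeasurableSpace Ω] [MeasurableSpace α] {P : Measure Ω}
    [IsProbabilityMeasure P] {Z : Ω → α} (hZ : Measurable Z) {φ : α → ℝ} (hφ : Measurable φ)
    {g : Ω → ℝ} (hf : Bd P (fun ω => φ (Z ω))) (hg : Bd P g) :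
    ∫ ω, φ (Z ω) * g ω ∂P = ∫ ω, φ (Z ω) * (P[g | sigmaAlg Z]) ω ∂P := by
  have hm : sigmaAlg Z ≤ ‹MeasurableSpace Ω› := hZ.comap_le
  have hmeas : StronglyMeasurable[sigmaAlg Z] (fun ω => φ (Z ω)) :=
    (hφ.comp (comap_measurable Z)).stronglyMeasurable
  have h := condExp_mul_of_stronglyMeasurable_left (μ := P) hmeas
    (hf.mul hg).integrable hg.integrable
  calc ∫ ω, φ (Z ω) * g ω ∂P = ∫ ω, (P[(fun ω => φ (Z ω)) * g | sigmaAlg Z]) ω ∂P :=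
        (integral_condExp hm).symm
    _ = _ := integral_congr_ae h

/-- Second moment of the score of Chipperfield et al.: with `S̃ := X·H` and
`H := (R·D + (1 − R)·π)·(Y* − μ)`, one has
`E[S̃ S̃ᵀ] = p·E[P(D=1|X)·μ·(1−μ)·X Xᵀ] + (1 − p)·E[π²·(Y* − μ)²·X Xᵀ]` (entrywise). -/
theorem score_second_moment
    {Ω : Type*} [MeasurableSpace Ω] (Pr : Measure Ω) [IsProbabilityMeasure Pr]
    {d : ℕ} (X : Ω → Fin d → ℝ) (Ystar D : Ω → ℝ) (β : Fin d → ℝ)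
    (hX : Measurable X) (hY : Measurable Ystar) (hD : Measurable D)
    (hXbd : ∃ C, ∀ ω i, |X ω i| ≤ C)
    (hY01 : ∀ ω, Ystar ω = 0 ∨ Ystar ω = 1)
    (hD01 : ∀ ω, D ω = 0 ∨ D ω = 1)
    (μ : Ω → ℝ)
    (hμ : ∀ ω, μ ω = Real.exp (∑ i, X ω i * β i) / (1 + Real.exp (∑ i, X ω i * β i)))
    (R : Ω → ℝ) (hR : Measurable R) (hR01 : ∀ ω, R ω = 0 ∨ R ω = 1)
    (p : ℝ) (hp : p ∈ Set.Icc (0 : ℝ) 1)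
    (hRp : Pr {ω | R ω = 1} = ENNReal.ofReal p)
    (hRindep : ProbabilityTheory.IndepFun R (fun ω => (X ω, Ystar ω, D ω)) Pr)
    (π : Ω → ℝ)
    (hπ : π =ᵐ[Pr] Pr[D | sigmaAlg fun ω => (X ω, Ystar ω)])
    (hNI : (fun ω => D ω *
        (Pr[fun ω' => Ystar ω' - μ ω' | sigmaAlg fun ω'' => (X ω'', D ω'')]) ω) =ᵐ[Pr] 0)
    (H : Ω → ℝ)
    (hH : ∀ ω, H ω = (R ω * D ω + (1 - R ω) * π ω) * (Ystar ω - μ ω))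
    :
    ∀ i j, ∫ ω, (X ω i * H ω) * (X ω j * H ω) ∂Pr
      = p * ∫ ω, (Pr[D | sigmaAlg X]) ω * (μ ω * (1 - μ ω)) * (X ω i * X ω j) ∂Pr
        + (1 - p) * ∫ ω, π ω ^ 2 * (Ystar ω - μ ω) ^ 2 * (X ω i * X ω j) ∂Pr := by
  intro i j
  obtain ⟨C, hC⟩ := hXbd
  -- the logistic function
  obtain ⟨l, hl⟩ : ∃ l : (Fin d → ℝ) → ℝ,
      l = fun x => Real.exp (∑ i, x i * β i) / (1 + Real.exp (∑ i, x i * β i)) := ⟨_, rfl⟩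
  have hlm : Measurable l := by
    rw [hl]; fun_prop
  have hμl : μ = fun ω => l (X ω) := by
    funext ω; rw [hμ, hl]
  have hl01 : ∀ x, |l x| ≤ 1 := by
    intro x
    rw [hl]
    have := Real.exp_pos (∑ i, x i * β i)
    rw [abs_of_nonneg (by positivity), div_le_one (by positivity)]
    linarith
  subst hμl
  have h01 : ∀ x : ℝ, x = 0 ∨ x = 1 → |x| ≤ 1 := by
    rintro x (h | h) <;> simp [h]
  have bX : ∀ i, Bd Pr (fun ω => X ω i) := fun i =>
    ⟨((measurable_pi_apply i).comp hX).aestronglyMeasurable, C, .of_forall fun ω => hC ω i⟩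
  have bY : Bd Pr Ystar := ⟨hY.aestronglyMeasurable, 1, .of_forall fun ω => h01 _ (hY01 ω)⟩
  have bD : Bd Pr D := ⟨hD.aestronglyMeasurable, 1, .of_forall fun ω => h01 _ (hD01 ω)⟩
  have bR : Bd Pr R := ⟨hR.aestronglyMeasurable, 1, .of_forall fun ω => h01 _ (hR01 ω)⟩
  have bμ : Bd Pr (fun ω => l (X ω)) :=
    ⟨(hlm.comp hX).aestronglyMeasurable, 1, .of_forall fun ω => hl01 _⟩
  -- the conditional expectation as a function of (X, Y)
  obtain ⟨ψ, hψm, hψ⟩ := (stronglyMeasurable_condExp (μ := Pr) (f := D)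
    (m := sigmaAlg fun ω => (X ω, Ystar ω))).exists_eq_measurable_comp
  have hπψ : π =ᵐ[Pr] fun ω => ψ (X ω, Ystar ω) := by
    rw [hψ] at hπ; exact hπ
  have bπ : Bd Pr (fun ω => ψ (X ω, Ystar ω)) := by
    refine ⟨(hψm.measurable.comp (hX.prodMk hY)).aestronglyMeasurable, 1, ?_⟩
    have := ae_bdd_abs_condExp_of_ae_bdd_abs (μ := Pr) (f := D) (R := 1)
      (m := sigmaAlg fun ω => (X ω, Ystar ω)) (.of_forall fun ω => by simpa using h01 _ (hD01 ω))
    rw [hψ] at this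
    simpa using this
  -- mean of R
  have hER : ∫ ω, R ω ∂Pr = p := by
    have : R = Set.indicator {ω | R ω = 1} (fun _ => (1 : ℝ)) := by
      funext ω
      rcases hR01 ω with h | h <;> simp [Set.indicator, h]
    have hS : MeasurableSet {ω | R ω = 1} := hR (measurableSet_singleton 1)
    rw [this, integral_indicator_const _ hS]
    simp [Measure.real, hRp, hp.1]
  -- independence
  have hind : ∀ φ : (Fin d → ℝ) × ℝ × ℝ → ℝ, Measurable φ →
      ∫ ω, R ω * φ (X ω, Ystar ω, D ω) ∂Pr = p * ∫ ω, φ (X ω, Ystar ω, D ω) ∂Pr := by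
    intro φ hφ
    have h1 : ProbabilityTheory.IndepFun R (fun ω => φ (X ω, Ystar ω, D ω)) Pr :=
      hRindep.comp measurable_id hφ
    have h2 := h1.integral_fun_mul_eq_mul_integral hR.aestronglyMeasurable
      (hφ.comp (hX.prodMk (hY.prodMk hD))).aestronglyMeasurable
    rw [h2, hER]
  obtain ⟨A, hA⟩ : ∃ A : Ω → ℝ, A = fun ω =>
    (D ω * ((Ystar ω - l (X ω)) * (Ystar ω - l (X ω)))) * (X ω i * X ω j) := ⟨_, rfl⟩
  obtain ⟨B, hB⟩ : ∃ B : Ω → ℝ, B = fun ω => ((ψ (X ω, Ystar ω) * ψ (X ω, Ystar ω)) *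
    ((Ystar ω - l (X ω)) * (Ystar ω - l (X ω)))) * (X ω i * X ω j) := ⟨_, rfl⟩
  have bA : Bd Pr A := by
    rw [hA]
    exact (bD.mul ((bY.sub bμ).mul (bY.sub bμ))).mul ((bX i).mul (bX j))
  have bB : Bd Pr B := by
    rw [hB]
    exact ((bπ.mul bπ).mul ((bY.sub bμ).mul (bY.sub bμ))).mul ((bX i).mul (bX j))
  have hψm' := hψm.measurable
  have hRA : ∫ ω, R ω * A ω ∂Pr = p * ∫ ω, A ω ∂Pr := by
    rw [hA]
    exact hind (fun z => (z.2.2 * ((z.2.1 - l z.1) * (z.2.1 - l z.1))) * (z.1 i * z.1 j))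
      (by fun_prop)
  have hRB : ∫ ω, R ω * B ω ∂Pr = p * ∫ ω, B ω ∂Pr := by
    rw [hB]
    exact hind (fun z => ((ψ (z.1, z.2.1) * ψ (z.1, z.2.1)) *
      ((z.2.1 - l z.1) * (z.2.1 - l z.1))) * (z.1 i * z.1 j)) (by fun_prop)
  have hL : ∫ ω, (X ω i * H ω) * (X ω j * H ω) ∂Pr
      = ∫ ω, ((R ω * A ω + B ω) - R ω * B ω) ∂Pr := by
    refine integral_congr_ae ?_
    filter_upwards [hπψ] with ω hω
    rw [hH, hA, hB, hω]
    rcases hR01 ω with h | h <;> rcases hD01 ω with h' | h' <;> simp only [h, h'] <;> ring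
  have hBint : ∫ ω, π ω ^ 2 * (Ystar ω - l (X ω)) ^ 2 * (X ω i * X ω j) ∂Pr = ∫ ω, B ω ∂Pr := by
    refine integral_congr_ae ?_
    filter_upwards [hπψ] with ω hω
    rw [hB, hω]
    ring
  have one := Bd.const (P := Pr) 1
  have two := Bd.const (P := Pr) 2
  have hz : ∫ ω, (D ω * ((1 - 2 * l (X ω)) * (X ω i * X ω j))) * (Ystar ω - l (X ω)) ∂Pr = 0 := by
    have h := pull_out (P := Pr) (hX.prodMk hD)
      (φ := fun z => z.2 * ((1 - 2 * l z.1) * (z.1 i * z.1 j))) (by fun_prop)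
      (bD.mul ((one.sub (two.mul bμ)).mul ((bX i).mul (bX j)))) (bY.sub bμ)
    refine h.trans (integral_eq_zero_of_ae ?_)
    filter_upwards [hNI] with ω hω
    simp only [Pi.zero_apply] at hω ⊢
    linear_combination ((1 - 2 * l (X ω)) * (X ω i * X ω j)) * hω
  have b1 := (bD.mul ((one.sub (two.mul bμ)).mul ((bX i).mul (bX j)))).mul (bY.sub bμ)
  have b2 := (bμ.mul (one.sub bμ)).mul ((bX i).mul (bX j))
  have hd : ∫ ω, (l (X ω) * (1 - l (X ω)) * (X ω i * X ω j)) * D ω ∂Pr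
      = ∫ ω, (Pr[D | sigmaAlg X]) ω * (l (X ω) * (1 - l (X ω))) * (X ω i * X ω j) ∂Pr := by
    have h := pull_out (P := Pr) hX
      (φ := fun x => l x * (1 - l x) * (x i * x j)) (by fun_prop) b2 bD
    refine h.trans (integral_congr_ae (.of_forall fun ω => ?_))
    ring
  have hAint : ∫ ω, A ω ∂Pr
      = ∫ ω, (Pr[D | sigmaAlg X]) ω * (l (X ω) * (1 - l (X ω))) * (X ω i * X ω j) ∂Pr := by
    rw [← hd, ← zero_add (∫ ω, (l (X ω) * (1 - l (X ω)) * (X ω i * X ω j)) * D ω ∂Pr), ← hz,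
      ← integral_add b1.integrable (b2.mul bD).integrable]
    refine integral_congr_ae (.of_forall fun ω => ?_)
    rcases hY01 ω with h | h <;> simp only [hA, h] <;> ring
  have hint : Integrable (fun ω => R ω * A ω + B ω) Pr :=
    (bR.mul bA).integrable.add bB.integrable
  beta_reduce
  rw [hL, integral_sub hint (bR.mul bB).integrable,
    integral_add (bR.mul bA).integrable bB.integrable, hRA, hRB, hBint, ← hAint]
  ring
end

section
/- (Lemma 2: failure of the score identity.) Under non-informative linkage and independent Bernoulli clerical sampling, E[(R·D + (1 − R)·π)·μ·(1−μ)·X Xᵀ] − E[H²·X Xᵀ] = (1 − p)·( E[P(D=1|X)·μ·(1−μ)·X Xᵀ] − E[π²·(Y* − μ)²·X Xᵀ] ), where the left-hand side equals E[−∂S̃/∂βᵀ] − E[S̃ S̃ᵀ] for the score S̃ := X·H, H := (R·D + (1 − R)·π)·(Y* − μ). -/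
open MeasureTheory

lemma aux_pull {Ω : Type*} {m m0 : MeasurableSpace Ω} (Pr : Measure Ω) [IsProbabilityMeasure Pr]
    (hm : m ≤ m0) (f g : Ω → ℝ) (hf : Measurable[m] f) (C : ℝ) (hC : ∀ ω, |f ω| ≤ C)
    (hg : Integrable g Pr) :
    ∫ ω, (Pr[g | m]) ω * f ω ∂Pr = ∫ ω, g ω * f ω ∂Pr := by
  have hfm : StronglyMeasurable[m] f := hf.stronglyMeasurable
  have hint : Integrable (f * g) Pr :=
    hg.bdd_mul (c := C) (hfm.mono hm).aestronglyMeasurable (Filter.Eventually.of_forall hC)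
  have h := condExp_mul_of_stronglyMeasurable_left (μ := Pr) hfm hint hg
  have h2 := integral_condExp hm (μ := Pr) (f := f * g)
  rw [integral_congr_ae h] at h2
  simpa [mul_comm] using h2

lemma aux_indep {Ω : Type*} {m m0 : MeasurableSpace Ω} (Pr : Measure Ω) [IsProbabilityMeasure Pr]
    (hm : m ≤ m0) (R : Ω → ℝ) (hR : Measurable R) (hR01 : ∀ ω, R ω = 0 ∨ R ω = 1)
    (p : ℝ) (hp : p ∈ Set.Icc (0 : ℝ) 1) (hRp : Pr {ω | R ω = 1} = ENNReal.ofReal p)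
    (hind : ProbabilityTheory.Indep (MeasurableSpace.comap R inferInstance) m Pr)
    (a b : Ω → ℝ) (ha : Measurable[m] a) (hb : Measurable[m] b)
    (hai : Integrable a Pr) (hbi : Integrable b Pr) :
    ∫ ω, (R ω * a ω + (1 - R ω) * b ω) ∂Pr = p * ∫ ω, a ω ∂Pr + (1 - p) * ∫ ω, b ω ∂Pr := by
  have hRint : ∫ ω, R ω ∂Pr = p := by
    have h1 : R = Set.indicator {ω | R ω = 1} (fun _ => (1 : ℝ)) := by
      funext ω
      rcases hR01 ω with h | h <;> simp [Set.indicator, h]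
    have hs : MeasurableSet {ω | R ω = 1} := hR (measurableSet_singleton 1)
    rw [h1, integral_indicator hs]
    simp [Measure.real, hRp, ENNReal.toReal_ofReal hp.1]
  have hRb : ∀ ω, ‖R ω‖ ≤ 1 := by
    intro ω
    rcases hR01 ω with h | h <;> simp [h]
  have key : ∀ f : Ω → ℝ, Measurable[m] f → ∫ ω, R ω * f ω ∂Pr = p * ∫ ω, f ω ∂Pr := by
    intro f hf
    have hi : ProbabilityTheory.IndepFun R f Pr := by
      rw [ProbabilityTheory.IndepFun_iff_Indep]
      exact ProbabilityTheory.indep_of_indep_of_le_right hind hf.comap_le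
    rw [hi.integral_fun_mul_eq_mul_integral hR.aestronglyMeasurable
      (hf.mono hm le_rfl).aestronglyMeasurable, hRint]
  have hRi : ∀ f : Ω → ℝ, Integrable f Pr → Integrable (fun ω => R ω * f ω) Pr := fun f hf =>
    hf.bdd_mul (c := 1) hR.aestronglyMeasurable (Filter.Eventually.of_forall hRb)
  have e : (fun ω => R ω * a ω + (1 - R ω) * b ω)
      = fun ω => (R ω * a ω + b ω) - R ω * b ω := by
    funext ω; ring
  rw [e, integral_sub (f := fun ω => R ω * a ω + b ω) ((hRi a hai).add hbi) (hRi b hbi), integral_add (hRi a hai) hbi,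
    key a ha, key b hb]
  ring

/-- Lemma 2 (failure of the score identity): under non-informative linkage and independent
Bernoulli clerical sampling,
`E[(R·D + (1 − R)·π)·μ·(1−μ)·X Xᵀ] − E[H²·X Xᵀ]
  = (1 − p)·(E[P(D=1|X)·μ·(1−μ)·X Xᵀ] − E[π²·(Y* − μ)²·X Xᵀ])` (entrywise),
where the left-hand side equals `E[−∂S̃/∂βᵀ] − E[S̃ S̃ᵀ]` for the score `S̃ := X·H`. -/
theorem score_identity_difference
    {Ω : Type*} [MeasurableSpace Ω] (Pr : Measure Ω) [IsProbabilityMeasure Pr]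
    {d : ℕ} (X : Ω → Fin d → ℝ) (Ystar D : Ω → ℝ) (β : Fin d → ℝ)
    (hX : Measurable X) (hY : Measurable Ystar) (hD : Measurable D)
    (hXbd : ∃ C, ∀ ω i, |X ω i| ≤ C)
    (hY01 : ∀ ω, Ystar ω = 0 ∨ Ystar ω = 1)
    (hD01 : ∀ ω, D ω = 0 ∨ D ω = 1)
    (μ : Ω → ℝ)
    (hμ : ∀ ω, μ ω = Real.exp (∑ i, X ω i * β i) / (1 + Real.exp (∑ i, X ω i * β i)))
    (R : Ω → ℝ) (hR : Measurable R) (hR01 : ∀ ω, R ω = 0 ∨ R ω = 1)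
    (p : ℝ) (hp : p ∈ Set.Icc (0 : ℝ) 1)
    (hRp : Pr {ω | R ω = 1} = ENNReal.ofReal p)
    (hRindep : ProbabilityTheory.IndepFun R (fun ω => (X ω, Ystar ω, D ω)) Pr)
    (π : Ω → ℝ)
    (hπ : π =ᵐ[Pr] Pr[D | sigmaAlg fun ω => (X ω, Ystar ω)])
    (hNI : (fun ω => D ω *
        (Pr[fun ω' => Ystar ω' - μ ω' | sigmaAlg fun ω'' => (X ω'', D ω'')]) ω) =ᵐ[Pr] 0)
    (H : Ω → ℝ)
    (hH : ∀ ω, H ω = (R ω * D ω + (1 - R ω) * π ω) * (Ystar ω - μ ω))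
    :
    ∀ i j,
      (∫ ω, (R ω * D ω + (1 - R ω) * π ω) * (μ ω * (1 - μ ω)) * (X ω i * X ω j) ∂Pr)
          - ∫ ω, H ω ^ 2 * (X ω i * X ω j) ∂Pr
        = (1 - p) *
            ((∫ ω, (Pr[D | sigmaAlg X]) ω * (μ ω * (1 - μ ω)) * (X ω i * X ω j) ∂Pr)
              - ∫ ω, π ω ^ 2 * (Ystar ω - μ ω) ^ 2 * (X ω i * X ω j) ∂Pr) := by
  intro i j
  obtain ⟨C, hC⟩ := hXbd
  have hmu0 : ∀ ω, 0 ≤ μ ω := fun ω => by rw [hμ]; positivity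
  have hmu1 : ∀ ω, μ ω ≤ 1 := fun ω => by
    rw [hμ, div_le_one (by positivity)]; linarith
  have hW : ∀ ω, |X ω i * X ω j| ≤ C * C := fun ω => by
    rw [abs_mul]
    exact mul_le_mul (hC ω i) (hC ω j) (abs_nonneg _) ((abs_nonneg _).trans (hC ω i))
  have hbd : ∀ t : ℝ, |t| ≤ 1 → ∀ ω, |t * (X ω i * X ω j)| ≤ C * C := fun t ht ω => by
    rw [abs_mul]
    have := hW ω
    nlinarith [abs_nonneg t, abs_nonneg (X ω i * X ω j)]
  have hv : ∀ ω, |μ ω * (1 - μ ω)| ≤ 1 := fun ω => by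
    have := hmu0 ω
    have := hmu1 ω
    rw [abs_le]; constructor <;> nlinarith
  have hY2 : ∀ ω, |(Ystar ω - μ ω) ^ 2| ≤ 1 := fun ω => by
    have := hmu0 ω
    have := hmu1 ω
    rw [abs_le]; rcases hY01 ω with h | h <;> rw [h] <;> constructor <;> nlinarith
  have hDb : ∀ ω, |D ω| ≤ 1 := fun ω => by rcases hD01 ω with h | h <;> simp [h]
  -- σ-algebras
  have hmX : sigmaAlg X ≤ ‹MeasurableSpace Ω› := hX.comap_le
  have hmXY : sigmaAlg (fun ω => (X ω, Ystar ω)) ≤ ‹MeasurableSpace Ω› :=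
    (hX.prodMk hY).comap_le
  have hmXD : sigmaAlg (fun ω => (X ω, D ω)) ≤ ‹MeasurableSpace Ω› :=
    (hX.prodMk hD).comap_le
  have hmZ : sigmaAlg (fun ω => (X ω, Ystar ω, D ω)) ≤ ‹MeasurableSpace Ω› :=
    (hX.prodMk (hY.prodMk hD)).comap_le
  have cX : Measurable[sigmaAlg X] X := comap_measurable X
  have cXY : Measurable[sigmaAlg (fun ω => (X ω, Ystar ω))] (fun ω => (X ω, Ystar ω)) :=
    comap_measurable _
  have cXD : Measurable[sigmaAlg (fun ω => (X ω, D ω))] (fun ω => (X ω, D ω)) :=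
    comap_measurable _
  have cZ : Measurable[sigmaAlg (fun ω => (X ω, Ystar ω, D ω))]
      (fun ω => (X ω, Ystar ω, D ω)) := comap_measurable _
  have hXXY : sigmaAlg X ≤ sigmaAlg (fun ω => (X ω, Ystar ω)) :=
    (measurable_fst.comp cXY).comap_le
  have hXXD : sigmaAlg X ≤ sigmaAlg (fun ω => (X ω, D ω)) :=
    (measurable_fst.comp cXD).comap_le
  have hXZ : sigmaAlg X ≤ sigmaAlg (fun ω => (X ω, Ystar ω, D ω)) :=
    (measurable_fst.comp cZ).comap_le
  have hXYZ : sigmaAlg (fun ω => (X ω, Ystar ω)) ≤ sigmaAlg (fun ω => (X ω, Ystar ω, D ω)) :=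
    ((measurable_fst.prodMk (measurable_fst.comp measurable_snd)).comp cZ).comap_le
  have mW : Measurable[sigmaAlg X] (fun ω => X ω i * X ω j) :=
    (show Measurable (fun x : Fin d → ℝ => x i * x j) by fun_prop).comp cX
  have mμ : Measurable[sigmaAlg X] μ := by
    have h : μ = (fun x : Fin d → ℝ => Real.exp (∑ i, x i * β i) /
        (1 + Real.exp (∑ i, x i * β i))) ∘ X := funext hμ
    rw [h]
    exact (show Measurable (fun x : Fin d → ℝ => Real.exp (∑ i, x i * β i) /
        (1 + Real.exp (∑ i, x i * β i))) by fun_prop).comp cX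
  have mvW : Measurable[sigmaAlg X] (fun ω => μ ω * (1 - μ ω) * (X ω i * X ω j)) :=
    (mμ.mul (measurable_const.sub mμ)).mul mW
  have mDZ : Measurable[sigmaAlg (fun ω => (X ω, Ystar ω, D ω))] D :=
    (measurable_snd.comp measurable_snd).comp cZ
  have mYZ : Measurable[sigmaAlg (fun ω => (X ω, Ystar ω, D ω))] Ystar :=
    (measurable_fst.comp measurable_snd).comp cZ
  have mDXD : Measurable[sigmaAlg (fun ω => (X ω, D ω))] D := measurable_snd.comp cXD
  have mμZ := mμ.mono hXZ le_rfl
  have mWZ := mW.mono hXZ le_rfl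
  have mvWZ := mvW.mono hXZ le_rfl
  have hvW : ∀ ω, |μ ω * (1 - μ ω) * (X ω i * X ω j)| ≤ C * C := fun ω => hbd _ (hv ω) ω
  have hY2W : ∀ ω, |(Ystar ω - μ ω) ^ 2 * (X ω i * X ω j)| ≤ C * C := fun ω => hbd _ (hY2 ω) ω
  have mY2WZ : Measurable[sigmaAlg (fun ω => (X ω, Ystar ω, D ω))]
      (fun ω => (Ystar ω - μ ω) ^ 2 * (X ω i * X ω j)) :=
    ((mYZ.sub mμZ).pow_const 2).mul mWZ
  have hDi : Integrable D Pr :=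
    Integrable.of_bound hD.aestronglyMeasurable 1 (Filter.Eventually.of_forall hDb)
  -- q, the version of π
  obtain ⟨q, hq⟩ : ∃ q, q = Pr[D | sigmaAlg fun ω => (X ω, Ystar ω)] := ⟨_, rfl⟩
  rw [← hq] at hπ
  have mqZ : Measurable[sigmaAlg (fun ω => (X ω, Ystar ω, D ω))] q := by
    rw [hq]; exact stronglyMeasurable_condExp.measurable.mono hXYZ le_rfl
  have hqi : Integrable q Pr := by rw [hq]; exact integrable_condExp
  have hqb : ∀ᵐ ω ∂Pr, |q ω| ≤ 1 := by
    rw [hq]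
    exact ae_bdd_abs_condExp_of_ae_bdd_abs (R := 1) (Filter.Eventually.of_forall hDb)
  have int1 : ∀ f g : Ω → ℝ, Integrable f Pr →
      Measurable[sigmaAlg (fun ω => (X ω, Ystar ω, D ω))] g → (∀ ω, |g ω| ≤ C * C) →
      Integrable (fun ω => f ω * g ω) Pr := fun f g hf hg hb =>
    hf.mul_bdd (c := C * C) (hg.mono hmZ le_rfl).aestronglyMeasurable
      (Filter.Eventually.of_forall hb)
  have hq2i : Integrable (fun ω => q ω ^ 2) Pr := by
    refine Integrable.of_bound ((mqZ.pow_const 2).mono hmZ le_rfl).aestronglyMeasurable 1 ?_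
    filter_upwards [hqb] with ω h
    rw [Real.norm_eq_abs, abs_pow]
    exact pow_le_one₀ (abs_nonneg _) h
  have hind : ProbabilityTheory.Indep (MeasurableSpace.comap R inferInstance)
      (sigmaAlg (fun ω => (X ω, Ystar ω, D ω))) Pr :=
    (ProbabilityTheory.IndepFun_iff_Indep _ _ _).1 hRindep
  -- (B)
  have B1 : ∫ ω, q ω * (μ ω * (1 - μ ω) * (X ω i * X ω j)) ∂Pr
      = ∫ ω, D ω * (μ ω * (1 - μ ω) * (X ω i * X ω j)) ∂Pr := by
    rw [hq]
    exact aux_pull Pr hmXY _ D (mvW.mono hXXY le_rfl) (C * C) hvW hDi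
  have B2 : ∫ ω, (Pr[D | sigmaAlg X]) ω * (μ ω * (1 - μ ω) * (X ω i * X ω j)) ∂Pr
      = ∫ ω, D ω * (μ ω * (1 - μ ω) * (X ω i * X ω j)) ∂Pr :=
    aux_pull Pr hmX _ D mvW (C * C) hvW hDi
  -- (C)
  have mg : Measurable[sigmaAlg (fun ω => (X ω, D ω))]
      (fun ω => D ω * (1 - 2 * μ ω) * (X ω i * X ω j)) :=
    (mDXD.mul (measurable_const.sub (measurable_const.mul (mμ.mono hXXD le_rfl)))).mul
      (mW.mono hXXD le_rfl)
  have hYi : Integrable (fun ω => Ystar ω - μ ω) Pr := by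
    refine Integrable.of_bound ((mYZ.sub mμZ).mono hmZ le_rfl).aestronglyMeasurable 1
      (Filter.Eventually.of_forall fun ω => ?_)
    have := hmu0 ω
    have := hmu1 ω
    rw [Real.norm_eq_abs, abs_le]
    rcases hY01 ω with h | h <;> rw [h] <;> constructor <;> linarith
  have C0 : ∫ ω, (Ystar ω - μ ω) * (D ω * (1 - 2 * μ ω) * (X ω i * X ω j)) ∂Pr = 0 := by
    rw [← aux_pull Pr hmXD _ (fun ω => Ystar ω - μ ω) mg (C * C) ?_ hYi]
    · rw [← integral_zero Ω ℝ (μ := Pr)]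
      refine integral_congr_ae ?_
      filter_upwards [hNI] with ω h
      simp only [Pi.zero_apply] at h
      linear_combination ((1 - 2 * μ ω) * (X ω i * X ω j)) * h
    · intro ω
      refine hbd _ ?_ ω
      have := hmu0 ω
      have := hmu1 ω
      rw [abs_le]
      rcases hD01 ω with h | h <;> rw [h] <;> constructor <;> linarith
  have C1 : ∫ ω, D ω * ((Ystar ω - μ ω) ^ 2 * (X ω i * X ω j)) ∂Pr
      = ∫ ω, D ω * (μ ω * (1 - μ ω) * (X ω i * X ω j)) ∂Pr := by
    rw [← sub_eq_zero, ← integral_sub (int1 _ _ hDi mY2WZ hY2W) (int1 _ _ hDi mvWZ hvW), ← C0]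
    refine integral_congr_ae (Filter.Eventually.of_forall fun ω => ?_)
    rcases hY01 ω with h | h <;> simp only [h] <;> ring
  -- assemble
  have L1 : ∫ ω, (R ω * D ω + (1 - R ω) * π ω) * (μ ω * (1 - μ ω)) * (X ω i * X ω j) ∂Pr
      = p * ∫ ω, D ω * (μ ω * (1 - μ ω) * (X ω i * X ω j)) ∂Pr
        + (1 - p) * ∫ ω, q ω * (μ ω * (1 - μ ω) * (X ω i * X ω j)) ∂Pr := by
    rw [← aux_indep Pr hmZ R hR hR01 p hp hRp hind
      (fun ω => D ω * (μ ω * (1 - μ ω) * (X ω i * X ω j)))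
      (fun ω => q ω * (μ ω * (1 - μ ω) * (X ω i * X ω j))) (mDZ.mul mvWZ) (mqZ.mul mvWZ)
      (int1 _ _ hDi mvWZ hvW) (int1 _ _ hqi mvWZ hvW)]
    refine integral_congr_ae ?_
    filter_upwards [hπ] with ω h
    rw [h]; ring
  have L2 : ∫ ω, H ω ^ 2 * (X ω i * X ω j) ∂Pr
      = p * ∫ ω, D ω * ((Ystar ω - μ ω) ^ 2 * (X ω i * X ω j)) ∂Pr
        + (1 - p) * ∫ ω, q ω ^ 2 * ((Ystar ω - μ ω) ^ 2 * (X ω i * X ω j)) ∂Pr := by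
    rw [← aux_indep Pr hmZ R hR hR01 p hp hRp hind
      (fun ω => D ω * ((Ystar ω - μ ω) ^ 2 * (X ω i * X ω j)))
      (fun ω => q ω ^ 2 * ((Ystar ω - μ ω) ^ 2 * (X ω i * X ω j))) (mDZ.mul mY2WZ)
      ((mqZ.pow_const 2).mul mY2WZ)
      (int1 _ _ hDi mY2WZ hY2W) (int1 _ _ hq2i mY2WZ hY2W)]
    refine integral_congr_ae ?_
    filter_upwards [hπ] with ω h
    rw [hH, h]
    rcases hR01 ω with h1 | h1 <;> rcases hD01 ω with h2 | h2 <;> rw [h1, h2] <;> ring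
  have L3 : ∫ ω, π ω ^ 2 * (Ystar ω - μ ω) ^ 2 * (X ω i * X ω j) ∂Pr
      = ∫ ω, q ω ^ 2 * ((Ystar ω - μ ω) ^ 2 * (X ω i * X ω j)) ∂Pr := by
    refine integral_congr_ae ?_
    filter_upwards [hπ] with ω h
    rw [h]; ring
  have L4 : ∫ ω, (Pr[D | sigmaAlg X]) ω * (μ ω * (1 - μ ω)) * (X ω i * X ω j) ∂Pr
      = ∫ ω, (Pr[D | sigmaAlg X]) ω * (μ ω * (1 - μ ω) * (X ω i * X ω j)) ∂Pr := by
    simp only [mul_assoc]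
  rw [L1, L2, L3, L4, B2, B1, C1]
  ring
end

section
/- Under independent Bernoulli clerical sampling, E[R·D + (1 − R)·π | σ(X)] = P(D = 1 | X) almost surely, where P(D=1|X) := E[D | σ(X)]; consequently the conditional expected Jacobian of H := (R·D + (1 − R)·π)·(Y* − μ) with respect to β satisfies E[∂H/∂β | σ(X)] = −P(D=1|X)·μ·(1 − μ)·X almost surely. -/
open MeasureTheory

/-- Under independent Bernoulli clerical sampling,
`E[R·D + (1 − R)·π | σ(X)] = P(D = 1 | X)` almost surely; consequently the conditional
expected Jacobian of `H := (R·D + (1 − R)·π)·(Y* − μ)` with respect to `β` satisfies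
`E[∂H/∂β | σ(X)] = −P(D=1|X)·μ·(1 − μ)·X` almost surely (using `∂μ/∂β = μ(1−μ)X`). -/
theorem condexp_weight_and_jacobian
    {Ω : Type*} [MeasurableSpace Ω] (Pr : Measure Ω) [IsProbabilityMeasure Pr]
    {d : ℕ} (X : Ω → Fin d → ℝ) (Ystar D : Ω → ℝ) (β : Fin d → ℝ)
    (hX : Measurable X) (hY : Measurable Ystar) (hD : Measurable D)
    (hXbd : ∃ C, ∀ ω i, |X ω i| ≤ C)
    (hY01 : ∀ ω, Ystar ω = 0 ∨ Ystar ω = 1)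
    (hD01 : ∀ ω, D ω = 0 ∨ D ω = 1)
    (μ : Ω → ℝ)
    (hμ : ∀ ω, μ ω = Real.exp (∑ i, X ω i * β i) / (1 + Real.exp (∑ i, X ω i * β i)))
    (R : Ω → ℝ) (hR : Measurable R) (hR01 : ∀ ω, R ω = 0 ∨ R ω = 1)
    (p : ℝ) (hp : p ∈ Set.Icc (0 : ℝ) 1)
    (hRp : Pr {ω | R ω = 1} = ENNReal.ofReal p)
    (hRindep : ProbabilityTheory.IndepFun R (fun ω => (X ω, Ystar ω, D ω)) Pr)
    (π : Ω → ℝ)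
    (hπ : π =ᵐ[Pr] Pr[D | sigmaAlg fun ω => (X ω, Ystar ω)])
    :
    (Pr[fun ω => R ω * D ω + (1 - R ω) * π ω | sigmaAlg X] =ᵐ[Pr] Pr[D | sigmaAlg X]) ∧
      ∀ i, Pr[fun ω => -((R ω * D ω + (1 - R ω) * π ω) * (μ ω * (1 - μ ω)) * X ω i) |
          sigmaAlg X]
        =ᵐ[Pr] fun ω => -((Pr[D | sigmaAlg X]) ω * (μ ω * (1 - μ ω)) * X ω i) := by
  have hle1 : sigmaAlg X ≤ ‹MeasurableSpace Ω› := hX.comap_le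
  have hZ : Measurable (fun ω => (X ω, Ystar ω, D ω)) := hX.prodMk (hY.prodMk hD)
  have hle3 : sigmaAlg (fun ω => (X ω, Ystar ω, D ω)) ≤ ‹MeasurableSpace Ω› := hZ.comap_le
  have hle2 : sigmaAlg (fun ω => (X ω, Ystar ω)) ≤ ‹MeasurableSpace Ω› :=
    (hX.prodMk hY).comap_le
  have hZ3 : Measurable[sigmaAlg (fun ω => (X ω, Ystar ω, D ω))]
      (fun ω => (X ω, Ystar ω, D ω)) := comap_measurable _
  have h12 : sigmaAlg X ≤ sigmaAlg (fun ω => (X ω, Ystar ω)) := by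
    have h : Measurable[sigmaAlg (fun ω => (X ω, Ystar ω))] (fun ω => (X ω, Ystar ω)) :=
      comap_measurable _
    exact (measurable_fst.comp h).comap_le
  have h23 : sigmaAlg (fun ω => (X ω, Ystar ω)) ≤ sigmaAlg (fun ω => (X ω, Ystar ω, D ω)) := by
    have h : Measurable[sigmaAlg (fun ω => (X ω, Ystar ω, D ω))] (fun ω => (X ω, Ystar ω)) :=
      (measurable_fst.prodMk (measurable_fst.comp measurable_snd)).comp hZ3
    exact h.comap_le
  have hD3 : StronglyMeasurable[sigmaAlg (fun ω => (X ω, Ystar ω, D ω))] D :=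
    ((measurable_snd.comp measurable_snd).comp hZ3).stronglyMeasurable
  have hDi : Integrable D Pr := by
    refine Integrable.of_bound hD.aestronglyMeasurable 1 (ae_of_all _ fun ω => ?_)
    rcases hD01 ω with h | h <;> simp [h]
  have hRb : ∀ᵐ ω ∂Pr, ‖R ω‖ ≤ 1 := by
    refine ae_of_all _ fun ω => ?_
    rcases hR01 ω with h | h <;> simp [h]
  have hRi : Integrable R Pr := Integrable.of_bound hR.aestronglyMeasurable 1 hRb
  have hRe : Pr[R | sigmaAlg (fun ω => (X ω, Ystar ω, D ω))] =ᵐ[Pr] fun _ => ∫ ω, R ω ∂Pr :=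
    condExp_indep_eq hR.comap_le hle3 (comap_measurable R).stronglyMeasurable hRindep
  have key : ∀ f : Ω → ℝ, StronglyMeasurable[sigmaAlg (fun ω => (X ω, Ystar ω, D ω))] f →
      Integrable f Pr →
      Pr[R * f | sigmaAlg X] =ᵐ[Pr] (∫ ω, R ω ∂Pr) • Pr[f | sigmaAlg X] := by
    intro f hf hfi
    have hRf : Integrable (R * f) Pr := hfi.bdd_mul hR.aestronglyMeasurable hRb
    have e1 : Pr[R * f | sigmaAlg (fun ω => (X ω, Ystar ω, D ω))] =ᵐ[Pr]
        (∫ ω, R ω ∂Pr) • f := by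
      filter_upwards [condExp_mul_of_stronglyMeasurable_right hf hRf hRi, hRe] with ω h1 h2
      rw [h1, Pi.mul_apply, h2]; rfl
    exact (condExp_condExp_of_le (h12.trans h23) hle3).symm.trans
      ((condExp_congr_ae e1).trans (condExp_smul _ _ _))
  set q : Ω → ℝ := Pr[D | sigmaAlg fun ω => (X ω, Ystar ω)] with hq
  have hqi : Integrable q Pr := integrable_condExp
  have hRD : Integrable (R * D) Pr := hDi.bdd_mul hR.aestronglyMeasurable hRb
  have hRq : Integrable (R * q) Pr := hqi.bdd_mul hR.aestronglyMeasurable hRb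
  have hW : (fun ω => R ω * D ω + (1 - R ω) * π ω) =ᵐ[Pr] R * D + (q - R * q) := by
    filter_upwards [hπ] with ω h
    simp only [Pi.add_apply, Pi.sub_apply, Pi.mul_apply, h]; ring
  have hWi : Integrable (fun ω => R ω * D ω + (1 - R ω) * π ω) Pr :=
    (hRD.add (hqi.sub hRq)).congr hW.symm
  have htow : Pr[q | sigmaAlg X] =ᵐ[Pr] Pr[D | sigmaAlg X] := condExp_condExp_of_le h12 hle2
  have main : Pr[fun ω => R ω * D ω + (1 - R ω) * π ω | sigmaAlg X] =ᵐ[Pr]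
      Pr[D | sigmaAlg X] := by
    filter_upwards [condExp_congr_ae (m := sigmaAlg X) hW,
      condExp_add hRD (hqi.sub hRq) (sigmaAlg X), condExp_sub hqi hRq (sigmaAlg X),
      key D hD3 hDi, key q (stronglyMeasurable_condExp.mono h23) hqi, htow]
      with ω h1 h2 h3 h4 h5 h6
    simp only [Pi.add_apply, Pi.sub_apply, Pi.smul_apply, smul_eq_mul] at h2 h3 h4 h5
    rw [h1, h2, h3, h4, h5, h6]; ring
  refine ⟨main, fun i => ?_⟩
  have hX1 : ∀ j, Measurable[sigmaAlg X] (fun ω => X ω j) := fun j =>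
    (measurable_pi_apply j).comp (comap_measurable X)
  have hμ1 : Measurable[sigmaAlg X] μ := by
    have hs : Measurable (fun x : Fin d → ℝ =>
      Real.exp (∑ i, x i * β i) / (1 + Real.exp (∑ i, x i * β i))) := by fun_prop
    have : μ = (fun x : Fin d → ℝ =>
      Real.exp (∑ i, x i * β i) / (1 + Real.exp (∑ i, x i * β i))) ∘ X := funext hμ
    rw [this]
    exact hs.comp (comap_measurable X)
  have hg1 : Measurable[sigmaAlg X] (fun ω => -(μ ω * (1 - μ ω) * X ω i)) :=
    ((hμ1.mul (measurable_const.sub hμ1)).mul (hX1 i)).neg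
  obtain ⟨C, hC⟩ := hXbd
  have hgb : ∀ᵐ ω ∂Pr, ‖-(μ ω * (1 - μ ω) * X ω i)‖ ≤ C := by
    refine ae_of_all _ fun ω => ?_
    have h0 : 0 ≤ μ ω := by rw [hμ]; positivity
    have h1 : μ ω ≤ 1 := by
      rw [hμ, div_le_one (by positivity)]; linarith
    have h2 : 0 ≤ μ ω * (1 - μ ω) := mul_nonneg h0 (by linarith)
    have h3 : μ ω * (1 - μ ω) ≤ 1 := by nlinarith
    rw [norm_neg, norm_mul, Real.norm_eq_abs, Real.norm_eq_abs, abs_of_nonneg h2]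
    calc _ ≤ 1 * |X ω i| := mul_le_mul_of_nonneg_right h3 (abs_nonneg _)
      _ ≤ C := by rw [one_mul]; exact hC ω i
  have hgW : Integrable ((fun ω => -(μ ω * (1 - μ ω) * X ω i)) *
      (fun ω => R ω * D ω + (1 - R ω) * π ω)) Pr :=
    hWi.bdd_mul (hg1.mono hle1 le_rfl).aestronglyMeasurable hgb
  have heq : (fun ω => -((R ω * D ω + (1 - R ω) * π ω) * (μ ω * (1 - μ ω)) * X ω i)) =
      (fun ω => -(μ ω * (1 - μ ω) * X ω i)) * (fun ω => R ω * D ω + (1 - R ω) * π ω) := by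
    funext ω
    simp only [Pi.mul_apply]; ring
  rw [heq]
  filter_upwards [condExp_mul_of_stronglyMeasurable_left hg1.stronglyMeasurable hgW hWi, main]
    with ω h1 h2
  rw [h1, Pi.mul_apply, h2]; ring
end

section
/- (Conditional variance of the optimal estimating function term.) Under non-informative linkage and independent Bernoulli clerical sampling, the term H := (R·D + (1 − R)·π)·(Y* − μ) satisfies E[H² | σ(X)] = p·μ·(1 − μ)·P(D=1|X) + (1 − p)·E[π²·(Y* − μ)² | σ(X)] almost surely, where P(D=1|X) := E[D | σ(X)]. -/
open MeasureTheory

theorem condexp_aux {Ω : Type*} {m0 : MeasurableSpace Ω} (Pr : Measure Ω) [IsProbabilityMeasure Pr]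
    (m' m mR : MeasurableSpace Ω) (h1 : m' ≤ m) (h2 : m ≤ m0) (hmR : mR ≤ m0)
    (R Z : Ω → ℝ) (hR : StronglyMeasurable[mR] R) (hind : ProbabilityTheory.Indep mR m Pr)
    (hRi : Integrable R Pr) (hZ : StronglyMeasurable[m] Z)
    (hRZ : Integrable (R * Z) Pr) (p : ℝ) (hp : ∫ ω, R ω ∂Pr = p) :
    Pr[R * Z | m'] =ᵐ[Pr] fun ω => p * (Pr[Z | m']) ω := by
  have e1 : Pr[R | m] =ᵐ[Pr] fun _ => p := by
    have := condExp_indep_eq hmR h2 hR hind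
    rwa [hp] at this
  have e2 : Pr[R * Z | m] =ᵐ[Pr] Pr[R | m] * Z :=
    condExp_mul_of_stronglyMeasurable_right hZ hRZ hRi
  have e3 : Pr[R * Z | m] =ᵐ[Pr] p • Z := by
    filter_upwards [e1, e2] with ω a b
    simp [b, a]
  have e4 : Pr[R * Z | m'] =ᵐ[Pr] Pr[Pr[R * Z | m] | m'] := (condExp_condExp_of_le h1 h2).symm
  have e5 := condExp_congr_ae (m := m') e3
  have e6 := condExp_smul (μ := Pr) p Z m'
  filter_upwards [e4, e5, e6] with ω a b c
  rw [a, b, c]; simp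

theorem integrable_bdd {Ω : Type*} {m0 : MeasurableSpace Ω} (Pr : Measure Ω)
    [IsProbabilityMeasure Pr] (f : Ω → ℝ) (hf : AEStronglyMeasurable f Pr)
    (h : ∀ᵐ ω ∂Pr, |f ω| ≤ 1) : Integrable f Pr :=
  Integrable.of_bound hf 1 h

/-- Conditional variance of the optimal estimating function term: under non-informative
linkage and independent Bernoulli clerical sampling, `H := (R·D + (1 − R)·π)·(Y* − μ)`
satisfies `E[H² | σ(X)] = p·μ·(1 − μ)·P(D=1|X) + (1 − p)·E[π²·(Y* − μ)² | σ(X)]` a.s. -/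
theorem condexp_H_sq
    {Ω : Type*} [MeasurableSpace Ω] (Pr : Measure Ω) [IsProbabilityMeasure Pr]
    {d : ℕ} (X : Ω → Fin d → ℝ) (Ystar D : Ω → ℝ) (β : Fin d → ℝ)
    (hX : Measurable X) (hY : Measurable Ystar) (hD : Measurable D)
    (hXbd : ∃ C, ∀ ω i, |X ω i| ≤ C)
    (hY01 : ∀ ω, Ystar ω = 0 ∨ Ystar ω = 1)
    (hD01 : ∀ ω, D ω = 0 ∨ D ω = 1)
    (μ : Ω → ℝ)
    (hμ : ∀ ω, μ ω = Real.exp (∑ i, X ω i * β i) / (1 + Real.exp (∑ i, X ω i * β i)))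
    (R : Ω → ℝ) (hR : Measurable R) (hR01 : ∀ ω, R ω = 0 ∨ R ω = 1)
    (p : ℝ) (hp : p ∈ Set.Icc (0 : ℝ) 1)
    (hRp : Pr {ω | R ω = 1} = ENNReal.ofReal p)
    (hRindep : ProbabilityTheory.IndepFun R (fun ω => (X ω, Ystar ω, D ω)) Pr)
    (π : Ω → ℝ)
    (hπ : π =ᵐ[Pr] Pr[D | sigmaAlg fun ω => (X ω, Ystar ω)])
    (hNI : (fun ω => D ω *
        (Pr[fun ω' => Ystar ω' - μ ω' | sigmaAlg fun ω'' => (X ω'', D ω'')]) ω) =ᵐ[Pr] 0)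
    (H : Ω → ℝ)
    (hH : ∀ ω, H ω = (R ω * D ω + (1 - R ω) * π ω) * (Ystar ω - μ ω))
    :
    Pr[fun ω => H ω ^ 2 | sigmaAlg X]
      =ᵐ[Pr] fun ω => p * (μ ω * (1 - μ ω)) * (Pr[D | sigmaAlg X]) ω
        + (1 - p) * (Pr[fun ω' => π ω' ^ 2 * (Ystar ω' - μ ω') ^ 2 | sigmaAlg X]) ω := by
  have hsX : sigmaAlg X ≤ (inferInstance : MeasurableSpace Ω) := hX.comap_le
  have hsXY : sigmaAlg (fun ω => (X ω, Ystar ω)) ≤ (inferInstance : MeasurableSpace Ω) :=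
    (hX.prodMk hY).comap_le
  have hsXD : sigmaAlg (fun ω => (X ω, D ω)) ≤ (inferInstance : MeasurableSpace Ω) :=
    (hX.prodMk hD).comap_le
  have hsW : sigmaAlg (fun ω => (X ω, Ystar ω, D ω)) ≤ (inferInstance : MeasurableSpace Ω) :=
    (hX.prodMk (hY.prodMk hD)).comap_le
  have mW : Measurable[sigmaAlg (fun ω => (X ω, Ystar ω, D ω))] (fun ω => (X ω, Ystar ω, D ω)) :=
    comap_measurable _
  have mXD : Measurable[sigmaAlg (fun ω => (X ω, D ω))] (fun ω => (X ω, D ω)) :=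
    comap_measurable _
  have mX : Measurable[sigmaAlg X] X := comap_measurable _
  have leXD : sigmaAlg X ≤ sigmaAlg (fun ω => (X ω, D ω)) :=
    (measurable_fst.comp mXD).comap_le
  have leXW : sigmaAlg X ≤ sigmaAlg (fun ω => (X ω, Ystar ω, D ω)) :=
    (measurable_fst.comp mW).comap_le
  have mWXY : Measurable[sigmaAlg (fun ω => (X ω, Ystar ω, D ω))] (fun ω => (X ω, Ystar ω)) :=
    (measurable_fst.prodMk (measurable_fst.comp measurable_snd)).comp mW
  have leXYW : sigmaAlg (fun ω => (X ω, Ystar ω)) ≤ sigmaAlg (fun ω => (X ω, Ystar ω, D ω)) :=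
    mWXY.comap_le
  have mμX : Measurable[sigmaAlg X] μ := by
    have hg : Measurable (fun x : Fin d → ℝ =>
        Real.exp (∑ i, x i * β i) / (1 + Real.exp (∑ i, x i * β i))) := by fun_prop
    have : μ = (fun x : Fin d → ℝ =>
        Real.exp (∑ i, x i * β i) / (1 + Real.exp (∑ i, x i * β i))) ∘ X := funext hμ
    rw [this]
    exact hg.comp mX
  have mμW : Measurable[sigmaAlg (fun ω => (X ω, Ystar ω, D ω))] μ := mμX.mono leXW le_rfl
  have mYW : Measurable[sigmaAlg (fun ω => (X ω, Ystar ω, D ω))] Ystar :=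
    (measurable_fst.comp measurable_snd).comp mW
  have mDW : Measurable[sigmaAlg (fun ω => (X ω, Ystar ω, D ω))] D :=
    (measurable_snd.comp measurable_snd).comp mW
  have mDXD : Measurable[sigmaAlg (fun ω => (X ω, D ω))] D := measurable_snd.comp mXD
  have mμ : Measurable μ := mμX.mono hsX le_rfl
  have hμ0 : ∀ ω, 0 ≤ μ ω := fun ω => by rw [hμ]; positivity
  have hμ1 : ∀ ω, μ ω ≤ 1 := fun ω => by
    rw [hμ, div_le_one (by positivity)]; linarith
  have bD : ∀ ω, |D ω| ≤ 1 := fun ω => by rcases hD01 ω with h | h <;> simp [h]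
  have bR : ∀ ω, |R ω| ≤ 1 := fun ω => by rcases hR01 ω with h | h <;> simp [h]
  have bYμ : ∀ ω, |Ystar ω - μ ω| ≤ 1 := fun ω => by
    rw [abs_le]
    rcases hY01 ω with h | h <;> rw [h] <;> constructor <;> linarith [hμ0 ω, hμ1 ω]
  have bmul : ∀ a b : ℝ, |a| ≤ 1 → |b| ≤ 1 → |a * b| ≤ 1 := fun a b ha hb => by
    rw [abs_mul]; exact mul_le_one₀ ha (abs_nonneg _) hb
  have bsq : ∀ a : ℝ, |a| ≤ 1 → |a ^ 2| ≤ 1 := fun a ha => by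
    rw [sq]; exact bmul a a ha ha
  set q : Ω → ℝ := Pr[D | sigmaAlg fun ω => (X ω, Ystar ω)] with hq
  have mqW : Measurable[sigmaAlg (fun ω => (X ω, Ystar ω, D ω))] q :=
    (stronglyMeasurable_condExp.mono leXYW).measurable
  have mq : Measurable q := mqW.mono hsW le_rfl
  have bq : ∀ᵐ ω ∂Pr, |q ω| ≤ 1 := by
    have := ae_bdd_condExp_of_ae_bdd (μ := Pr) (m := sigmaAlg fun ω => (X ω, Ystar ω))
      (R := 1) (f := D) (Filter.Eventually.of_forall (fun ω => by simpa using bD ω))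
    simpa using this
  have iR : Integrable R Pr :=
    integrable_bdd Pr R hR.aestronglyMeasurable (Filter.Eventually.of_forall bR)
  have iD : Integrable D Pr :=
    integrable_bdd Pr D hD.aestronglyMeasurable (Filter.Eventually.of_forall bD)
  have iYμ : Integrable (fun ω => Ystar ω - μ ω) Pr :=
    integrable_bdd Pr _ (hY.sub mμ).aestronglyMeasurable (Filter.Eventually.of_forall bYμ)
  have intR : ∫ ω, R ω ∂Pr = p := by
    have hS : MeasurableSet {ω | R ω = 1} := hR (measurableSet_singleton 1)
    have : R = Set.indicator {ω | R ω = 1} (fun _ => (1 : ℝ)) := by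
      funext ω
      rcases hR01 ω with h | h <;> simp [Set.indicator, h]
    rw [this, integral_indicator_const _ hS, measureReal_def, hRp]
    simp [ENNReal.toReal_ofReal hp.1]
  have hind : ProbabilityTheory.Indep (sigmaAlg R) (sigmaAlg (fun ω => (X ω, Ystar ω, D ω))) Pr :=
    hRindep
  let G1 : Ω → ℝ := fun ω => D ω * (Ystar ω - μ ω) ^ 2
  let G2 : Ω → ℝ := fun ω => q ω ^ 2 * (Ystar ω - μ ω) ^ 2
  have mG1 : Measurable[sigmaAlg (fun ω => (X ω, Ystar ω, D ω))] G1 :=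
    mDW.mul ((mYW.sub mμW).pow_const 2)
  have mG2 : Measurable[sigmaAlg (fun ω => (X ω, Ystar ω, D ω))] G2 :=
    (mqW.pow_const 2).mul ((mYW.sub mμW).pow_const 2)
  have bG1 : ∀ ω, |G1 ω| ≤ 1 := fun ω => bmul _ _ (bD ω) (bsq _ (bYμ ω))
  have bG2 : ∀ᵐ ω ∂Pr, |G2 ω| ≤ 1 := by
    filter_upwards [bq] with ω h
    exact bmul _ _ (bsq _ h) (bsq _ (bYμ ω))
  have mG1' : Measurable G1 := mG1.mono hsW le_rfl
  have mG2' : Measurable G2 := mG2.mono hsW le_rfl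
  have iG2 : Integrable G2 Pr := integrable_bdd Pr _ mG2'.aestronglyMeasurable bG2
  have iRG1 : Integrable (R * G1) Pr :=
    integrable_bdd Pr _ (hR.mul mG1').aestronglyMeasurable
      (Filter.Eventually.of_forall fun ω => bmul _ _ (bR ω) (bG1 ω))
  have iRG2 : Integrable (R * G2) Pr := by
    refine integrable_bdd Pr _ (hR.mul mG2').aestronglyMeasurable ?_
    filter_upwards [bG2] with ω h
    exact bmul _ _ (bR ω) h
  have mRR : StronglyMeasurable[sigmaAlg R] R :=
    (comap_measurable R : Measurable[sigmaAlg R] R).stronglyMeasurable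
  have c1 := condexp_aux Pr (sigmaAlg X) _ (sigmaAlg R) leXW hsW hR.comap_le R G1 mRR hind iR
    mG1.stronglyMeasurable iRG1 p intR
  have c2 := condexp_aux Pr (sigmaAlg X) _ (sigmaAlg R) leXW hsW hR.comap_le R G2 mRR hind iR
    mG2.stronglyMeasurable iRG2 p intR
  -- the linkage term
  let K : Ω → ℝ := fun ω => Ystar ω - μ ω
  have iDK : Integrable (D * K) Pr :=
    integrable_bdd Pr _ (hD.mul (hY.sub mμ)).aestronglyMeasurable
      (Filter.Eventually.of_forall fun ω => bmul _ _ (bD ω) (bYμ ω))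
  have k1 : Pr[D * K | sigmaAlg (fun ω => (X ω, D ω))] =ᵐ[Pr] 0 := by
    have := condExp_mul_of_stronglyMeasurable_left (μ := Pr) mDXD.stronglyMeasurable iDK iYμ
    exact this.trans hNI
  have k2 : Pr[D * K | sigmaAlg X] =ᵐ[Pr] 0 := by
    have a := condExp_condExp_of_le (μ := Pr) (f := D * K) leXD hsXD
    have b := condExp_congr_ae (m := sigmaAlg X) k1
    rw [condExp_zero] at b
    exact a.symm.trans b
  let A : Ω → ℝ := fun ω => 1 - 2 * μ ω
  let B : Ω → ℝ := fun ω => μ ω * (1 - μ ω)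
  have mA : Measurable[sigmaAlg X] A := (mμX.const_mul 2).const_sub 1
  have mB : Measurable[sigmaAlg X] B := mμX.mul (mμX.const_sub 1)
  have bA : ∀ ω, |A ω| ≤ 1 := fun ω => by
    rw [abs_le]; constructor <;> simp only [A] <;> linarith [hμ0 ω, hμ1 ω]
  have bB : ∀ ω, |B ω| ≤ 1 := fun ω => by
    refine bmul _ _ ?_ ?_ <;> rw [abs_le] <;> constructor <;> linarith [hμ0 ω, hμ1 ω]
  have iADK : Integrable (A * (D * K)) Pr :=
    integrable_bdd Pr _ ((mA.mono hsX le_rfl).mul (hD.mul (hY.sub mμ))).aestronglyMeasurable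
      (Filter.Eventually.of_forall fun ω => bmul _ _ (bA ω) (bmul _ _ (bD ω) (bYμ ω)))
  have iBD : Integrable (B * D) Pr :=
    integrable_bdd Pr _ ((mB.mono hsX le_rfl).mul hD).aestronglyMeasurable
      (Filter.Eventually.of_forall fun ω => bmul _ _ (bB ω) (bD ω))
  have eG1 : G1 = A * (D * K) + B * D := by
    funext ω
    simp only [G1, A, B, K, Pi.add_apply, Pi.mul_apply]
    rcases hY01 ω with h | h <;> rw [h] <;> ring
  have g1 : Pr[G1 | sigmaAlg X] =ᵐ[Pr] fun ω => B ω * (Pr[D | sigmaAlg X]) ω := by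
    rw [eG1]
    filter_upwards [condExp_add iADK iBD (sigmaAlg X),
      condExp_mul_of_stronglyMeasurable_left (μ := Pr) mA.stronglyMeasurable iADK iDK,
      condExp_mul_of_stronglyMeasurable_left (μ := Pr) mB.stronglyMeasurable iBD iD, k2]
      with ω a b c e
    simp [a, b, c, e]
  have eH : (fun ω => H ω ^ 2) =ᵐ[Pr] (R * G1 + (G2 - R * G2)) := by
    filter_upwards [hπ] with ω h
    simp only [hH, h, G1, G2, Pi.add_apply, Pi.mul_apply, Pi.sub_apply]
    rcases hR01 ω with h | h <;> rcases hD01 ω with h' | h' <;> rw [h, h'] <;> ring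
  have eπ : (fun ω' => π ω' ^ 2 * (Ystar ω' - μ ω') ^ 2) =ᵐ[Pr] G2 := by
    filter_upwards [hπ] with ω h
    simp only [h, G2]
  filter_upwards [condExp_congr_ae (m := sigmaAlg X) eH, condExp_congr_ae (m := sigmaAlg X) eπ,
    condExp_add iRG1 (iG2.sub iRG2) (sigmaAlg X), condExp_sub iG2 iRG2 (sigmaAlg X), c1, c2, g1]
    with ω a b c e f g h
  rw [a, b, c, Pi.add_apply, e, Pi.sub_apply, f, g, h]
  simp only [B]
  ring
end

section
/- (Optimal multiplier for the quasi-likelihood estimating equation.) Under non-informative linkage and independent Bernoulli clerical sampling, if p·μ·(1−μ)·P(D=1|X) + (1−p)·E[π²·(Y*−μ)² | σ(X)] > 0 almost surely, then the optimal multiplier A* := E[∂H/∂β | σ(X)]ᵀ · (E[H² | σ(X)])⁻¹ satisfies, almost surely, A* = −X · μ·(1−μ)·P(D=1|X) / ( p·μ·(1−μ)·P(D=1|X) + (1−p)·E[π²·(Y*−μ)² | σ(X)] ). -/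
open MeasureTheory

theorem optmul_key {Ω : Type*} {m m2 m0 : MeasurableSpace Ω} (Pr : Measure Ω)
    [IsProbabilityMeasure Pr] (hm : m ≤ m2) (hm2 : m2 ≤ m0) (Z f : Ω → ℝ)
    (hZ : Measurable[m0] Z) (hZb : ∀ ω, |Z ω| ≤ 1)
    (hind : ProbabilityTheory.Indep (MeasurableSpace.comap Z inferInstance) m2 Pr)
    (q : ℝ) (hq : ∫ ω, Z ω ∂Pr = q)
    (hf : StronglyMeasurable[m2] f) (hfi : Integrable f Pr) :
    Integrable (fun ω => Z ω * f ω) Pr ∧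
      Pr[fun ω => Z ω * f ω | m] =ᵐ[Pr] fun ω => q * (Pr[f | m]) ω := by
  have hZm : AEStronglyMeasurable Z Pr := hZ.aestronglyMeasurable
  have hZi : Integrable Z Pr :=
    Integrable.of_bound hZm 1 (Filter.Eventually.of_forall hZb)
  have hi : Integrable (fun ω => Z ω * f ω) Pr :=
    hfi.bdd_mul hZm (Filter.Eventually.of_forall hZb)
  refine ⟨hi, ?_⟩
  have h1 : Pr[fun ω => Z ω * f ω | m2] =ᵐ[Pr] fun ω => q * f ω := by
    have h2 : Pr[fun ω => Z ω * f ω | m2] =ᵐ[Pr] Pr[Z | m2] * f :=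
      condExp_mul_of_stronglyMeasurable_right hf hi hZi
    have h3 : Pr[Z | m2] =ᵐ[Pr] fun _ => ∫ ω, Z ω ∂Pr :=
      condExp_indep_eq hZ.comap_le hm2 (comap_measurable Z).stronglyMeasurable hind
    filter_upwards [h2, h3] with ω a b
    rw [a, Pi.mul_apply, b, hq]
  have h4 := condExp_condExp_of_le (μ := Pr) (f := fun ω => Z ω * f ω) hm hm2
  have h5 := condExp_congr_ae (m := m) h1
  have h6 : Pr[fun ω => q * f ω | m] =ᵐ[Pr] fun ω => q * (Pr[f | m]) ω :=
    condExp_smul (μ := Pr) q f m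
  exact h4.symm.trans (h5.trans h6)

/-- Optimal multiplier for the quasi-likelihood estimating equation: under non-informative
linkage and independent Bernoulli clerical sampling, if
`p·μ·(1−μ)·P(D=1|X) + (1−p)·E[π²·(Y*−μ)² | σ(X)] > 0` a.s., then the optimal multiplier
`A* := E[∂H/∂β | σ(X)]ᵀ · (E[H² | σ(X)])⁻¹` satisfies, almost surely,
`A* = −X·μ·(1−μ)·P(D=1|X) / (p·μ·(1−μ)·P(D=1|X) + (1−p)·E[π²·(Y*−μ)² | σ(X)])`. -/
theorem optimal_multiplier
    {Ω : Type*} [MeasurableSpace Ω] (Pr : Measure Ω) [IsProbabilityMeasure Pr]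
    {d : ℕ} (X : Ω → Fin d → ℝ) (Ystar D : Ω → ℝ) (β : Fin d → ℝ)
    (hX : Measurable X) (hY : Measurable Ystar) (hD : Measurable D)
    (hXbd : ∃ C, ∀ ω i, |X ω i| ≤ C)
    (hY01 : ∀ ω, Ystar ω = 0 ∨ Ystar ω = 1)
    (hD01 : ∀ ω, D ω = 0 ∨ D ω = 1)
    (μ : Ω → ℝ)
    (hμ : ∀ ω, μ ω = Real.exp (∑ i, X ω i * β i) / (1 + Real.exp (∑ i, X ω i * β i)))
    (R : Ω → ℝ) (hR : Measurable R) (hR01 : ∀ ω, R ω = 0 ∨ R ω = 1)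
    (p : ℝ) (hp : p ∈ Set.Icc (0 : ℝ) 1)
    (hRp : Pr {ω | R ω = 1} = ENNReal.ofReal p)
    (hRindep : ProbabilityTheory.IndepFun R (fun ω => (X ω, Ystar ω, D ω)) Pr)
    (π : Ω → ℝ)
    (hπ : π =ᵐ[Pr] Pr[D | sigmaAlg fun ω => (X ω, Ystar ω)])
    (hNI : (fun ω => D ω *
        (Pr[fun ω' => Ystar ω' - μ ω' | sigmaAlg fun ω'' => (X ω'', D ω'')]) ω) =ᵐ[Pr] 0)
    (H : Ω → ℝ)
    (hH : ∀ ω, H ω = (R ω * D ω + (1 - R ω) * π ω) * (Ystar ω - μ ω))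
    (hpos : ∀ᵐ ω ∂Pr, 0 < p * (μ ω * (1 - μ ω)) * (Pr[D | sigmaAlg X]) ω
        + (1 - p) * (Pr[fun ω' => π ω' ^ 2 * (Ystar ω' - μ ω') ^ 2 | sigmaAlg X]) ω)
    :
    ∀ i, (fun ω =>
        (Pr[fun ω' => -((R ω' * D ω' + (1 - R ω') * π ω') * (μ ω' * (1 - μ ω')) * X ω' i) |
            sigmaAlg X]) ω * ((Pr[fun ω' => H ω' ^ 2 | sigmaAlg X]) ω)⁻¹)
      =ᵐ[Pr] fun ω =>
        -(X ω i * (μ ω * (1 - μ ω)) * (Pr[D | sigmaAlg X]) ω /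
          (p * (μ ω * (1 - μ ω)) * (Pr[D | sigmaAlg X]) ω
            + (1 - p) * (Pr[fun ω' => π ω' ^ 2 * (Ystar ω' - μ ω') ^ 2 | sigmaAlg X]) ω)) := by
  classical
  intro i
  obtain ⟨C, hC⟩ := hXbd
  have hμ0 : ∀ ω, 0 ≤ μ ω := fun ω => by rw [hμ]; positivity
  have hμ1 : ∀ ω, μ ω ≤ 1 := fun ω => by
    rw [hμ, div_le_one (by positivity)]; linarith
  have hmX0 : sigmaAlg X ≤ ‹MeasurableSpace Ω› := hX.comap_le
  have hXX : Measurable[sigmaAlg X] X := comap_measurable X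
  have hXi : ∀ j, Measurable[sigmaAlg X] (fun ω => X ω j) := fun j =>
    (measurable_pi_apply j).comp hXX
  have hμX : Measurable[sigmaAlg X] μ := by
    have : μ = (fun x : Fin d → ℝ =>
        Real.exp (∑ i, x i * β i) / (1 + Real.exp (∑ i, x i * β i))) ∘ X := funext hμ
    rw [this]
    exact Measurable.comp (by fun_prop) hXX
  have hT : Measurable[(sigmaAlg fun ω => (X ω, Ystar ω, D ω))] fun ω => (X ω, Ystar ω, D ω) := comap_measurable _
  have hm2 : (sigmaAlg fun ω => (X ω, Ystar ω, D ω)) ≤ ‹MeasurableSpace Ω› := (hX.prodMk (hY.prodMk hD)).comap_le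
  have hmXY0 : (sigmaAlg fun ω => (X ω, Ystar ω)) ≤ ‹MeasurableSpace Ω› := (hX.prodMk hY).comap_le
  have hmXD0 : (sigmaAlg fun ω => (X ω, D ω)) ≤ ‹MeasurableSpace Ω› := (hX.prodMk hD).comap_le
  have hX2 : Measurable[(sigmaAlg fun ω => (X ω, Ystar ω, D ω))] X := measurable_fst.comp hT
  have hY2 : Measurable[(sigmaAlg fun ω => (X ω, Ystar ω, D ω))] Ystar := (measurable_fst.comp measurable_snd).comp hT
  have hD2 : Measurable[(sigmaAlg fun ω => (X ω, Ystar ω, D ω))] D := (measurable_snd.comp measurable_snd).comp hT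
  have hmX2 : sigmaAlg X ≤ (sigmaAlg fun ω => (X ω, Ystar ω, D ω)) := hX2.comap_le
  have hmXY2 : (sigmaAlg fun ω => (X ω, Ystar ω)) ≤ (sigmaAlg fun ω => (X ω, Ystar ω, D ω)) :=
    (hX2.prodMk hY2).comap_le
  have hmXXY : sigmaAlg X ≤ (sigmaAlg fun ω => (X ω, Ystar ω)) :=
    (measurable_fst.comp (comap_measurable (fun ω => (X ω, Ystar ω)))).comap_le
  have hmXXD : sigmaAlg X ≤ (sigmaAlg fun ω => (X ω, D ω)) :=
    (measurable_fst.comp (comap_measurable (fun ω => (X ω, D ω)))).comap_le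
  have hDXD : Measurable[(sigmaAlg fun ω => (X ω, D ω))] D :=
    measurable_snd.comp (comap_measurable (fun ω => (X ω, D ω)))
  have hμ2 : Measurable[(sigmaAlg fun ω => (X ω, Ystar ω, D ω))] μ := hμX.mono hmX2 le_rfl
  have hμm : Measurable μ := hμX.mono hmX0 le_rfl
  have hDb : ∀ ω, |D ω| ≤ 1 := fun ω => by rcases hD01 ω with h | h <;> simp [h]
  have hRb : ∀ ω, |R ω| ≤ 1 := fun ω => by rcases hR01 ω with h | h <;> simp [h]
  have hRb' : ∀ ω, |1 - R ω| ≤ 1 := fun ω => by rcases hR01 ω with h | h <;> simp [h]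
  have hWb : ∀ ω, |Ystar ω - μ ω| ≤ 1 := fun ω => by
    have := hμ0 ω
    have := hμ1 ω
    rw [abs_le]
    rcases hY01 ω with h | h <;> rw [h] <;> constructor <;> linarith
  have hDi : Integrable D Pr :=
    Integrable.of_bound hD.aestronglyMeasurable 1 (Filter.Eventually.of_forall hDb)
  have hWi : Integrable (fun ω => Ystar ω - μ ω) Pr :=
    Integrable.of_bound (hY.sub hμm).aestronglyMeasurable 1 (Filter.Eventually.of_forall hWb)
  -- the version of the match probability
  set ρ : Ω → ℝ := Pr[D | (sigmaAlg fun ω => (X ω, Ystar ω))] with hρ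
  have hρm : StronglyMeasurable[(sigmaAlg fun ω => (X ω, Ystar ω, D ω))] ρ := stronglyMeasurable_condExp.mono hmXY2
  have hρm0 : StronglyMeasurable ρ := hρm.mono hm2
  have hρb : ∀ᵐ ω ∂Pr, |ρ ω| ≤ 1 :=
    ae_bdd_abs_condExp_of_ae_bdd_abs (Filter.Eventually.of_forall hDb)
  have hρi : Integrable ρ Pr := integrable_condExp
  -- mean of R
  have hRint : ∫ ω, R ω ∂Pr = p := by
    have h1 : R = Set.indicator {ω | R ω = 1} (fun _ => (1 : ℝ)) := by
      funext ω
      rcases hR01 ω with h | h <;> simp [Set.indicator, h]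
    have hms : MeasurableSet {ω | R ω = 1} := hR (measurableSet_singleton 1)
    have h2 : ∫ ω, R ω ∂Pr = ∫ ω, Set.indicator {ω | R ω = 1} (fun _ => (1 : ℝ)) ω ∂Pr :=
      congrArg (fun g : Ω → ℝ => ∫ ω, g ω ∂Pr) h1
    rw [h2, integral_indicator hms]
    simp [Measure.real, hRp, hp.1]
  have hRi : Integrable R Pr :=
    Integrable.of_bound hR.aestronglyMeasurable 1 (Filter.Eventually.of_forall hRb)
  have hRint' : ∫ ω, (1 - R ω) ∂Pr = 1 - p := by
    rw [integral_sub (integrable_const _) hRi, hRint]; simp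
  have hind1 : ProbabilityTheory.Indep (MeasurableSpace.comap R inferInstance) (sigmaAlg fun ω => (X ω, Ystar ω, D ω)) Pr :=
    (ProbabilityTheory.IndepFun_iff_Indep _ _ _).1 hRindep
  have hind2 : ProbabilityTheory.Indep
      (MeasurableSpace.comap (fun ω => 1 - R ω) inferInstance) (sigmaAlg fun ω => (X ω, Ystar ω, D ω)) Pr :=
    (ProbabilityTheory.IndepFun_iff_Indep _ _ _).1
      (hRindep.comp (φ := fun r : ℝ => 1 - r) (ψ := id) (by fun_prop) measurable_id)
  have key1 := fun f hf hfi => optmul_key Pr hmX2 hm2 R f hR hRb hind1 p hRint hf hfi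
  have key2 := fun f hf hfi => optmul_key Pr hmX2 hm2 (fun ω => 1 - R ω) f
    (measurable_const.sub hR) hRb' hind2 (1 - p) hRint' hf hfi
  -- combination
  have comb : ∀ f g F : Ω → ℝ, StronglyMeasurable[(sigmaAlg fun ω => (X ω, Ystar ω, D ω))] f → Integrable f Pr →
      StronglyMeasurable[(sigmaAlg fun ω => (X ω, Ystar ω, D ω))] g → Integrable g Pr →
      F =ᵐ[Pr] (fun ω => R ω * f ω + (1 - R ω) * g ω) →
      Pr[F | sigmaAlg X] =ᵐ[Pr] fun ω => p * (Pr[f | sigmaAlg X]) ω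
        + (1 - p) * (Pr[g | sigmaAlg X]) ω := by
    intro f g F hf hfi hg hgi hF
    obtain ⟨i1, e1⟩ := key1 f hf hfi
    obtain ⟨i2, e2⟩ := key2 g hg hgi
    have e3 := condExp_add i1 i2 (sigmaAlg X)
    have e4 := condExp_congr_ae (m := sigmaAlg X) hF
    filter_upwards [e1, e2, e3, e4] with ω a b c d
    rw [d]
    refine c.trans ?_
    rw [Pi.add_apply, a, b]
  -- the weight
  set k : Ω → ℝ := fun ω => -(μ ω * (1 - μ ω) * X ω i) with hk
  have hkX : Measurable[sigmaAlg X] k :=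
    ((hμX.mul (measurable_const.sub hμX)).mul (hXi i)).neg
  have hvb : ∀ ω, |μ ω * (1 - μ ω)| ≤ 1 := fun ω => by
    have := hμ0 ω
    have := hμ1 ω
    rw [abs_le]
    constructor <;> nlinarith
  have hkb : ∀ ω, ‖k ω‖ ≤ C := fun ω => by
    have h1 := hC ω i
    have h2 := hvb ω
    simp only [hk, norm_neg, Real.norm_eq_abs, abs_mul (μ ω * (1 - μ ω)) (X ω i)]
    nlinarith [abs_nonneg (X ω i)]
  have hkm0 : Measurable k := hkX.mono hmX0 le_rfl
  have hk2 : Measurable[(sigmaAlg fun ω => (X ω, Ystar ω, D ω))] k := hkX.mono hmX2 le_rfl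
  have hkDi : Integrable (fun ω => k ω * D ω) Pr :=
    hDi.bdd_mul hkm0.aestronglyMeasurable (Filter.Eventually.of_forall hkb)
  have hkρi : Integrable (fun ω => k ω * ρ ω) Pr :=
    hρi.bdd_mul hkm0.aestronglyMeasurable (Filter.Eventually.of_forall hkb)
  have J1 : Pr[fun ω => k ω * D ω | sigmaAlg X] =ᵐ[Pr] k * Pr[D | sigmaAlg X] :=
    condExp_mul_of_stronglyMeasurable_left hkX.stronglyMeasurable hkDi hDi
  have J2 : Pr[fun ω => k ω * ρ ω | sigmaAlg X] =ᵐ[Pr] k * Pr[ρ | sigmaAlg X] :=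
    condExp_mul_of_stronglyMeasurable_left hkX.stronglyMeasurable hkρi hρi
  have J3 : Pr[ρ | sigmaAlg X] =ᵐ[Pr] Pr[D | sigmaAlg X] :=
    condExp_condExp_of_le hmXXY hmXY0
  have J := comb (fun ω => k ω * D ω) (fun ω => k ω * ρ ω)
    (fun ω' => -((R ω' * D ω' + (1 - R ω') * π ω') * (μ ω' * (1 - μ ω')) * X ω' i))
    (hk2.mul hD2).stronglyMeasurable hkDi
    (hk2.stronglyMeasurable.mul hρm) hkρi (by
      filter_upwards [hπ] with ω h
      rw [h]
      simp only [hk]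
      ring)
  -- the variance
  have hWsqm : Measurable[(sigmaAlg fun ω => (X ω, Ystar ω, D ω))] fun ω => (Ystar ω - μ ω) ^ 2 := (hY2.sub hμ2).pow_const 2
  have hWsqb : ∀ ω, |(Ystar ω - μ ω) ^ 2| ≤ 1 := fun ω => by
    rw [abs_pow]; exact pow_le_one₀ (abs_nonneg _) (hWb ω)
  have hDWi : Integrable (fun ω => (Ystar ω - μ ω) ^ 2 * D ω) Pr :=
    hDi.bdd_mul (hWsqm.mono hm2 le_rfl).aestronglyMeasurable (Filter.Eventually.of_forall hWsqb)
  have hρWi : Integrable (fun ω => ρ ω ^ 2 * (Ystar ω - μ ω) ^ 2) Pr := by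
    refine Integrable.of_bound
      ((hρm0.pow 2).mul (hWsqm.mono hm2 le_rfl).stronglyMeasurable).aestronglyMeasurable 1 ?_
    filter_upwards [hρb] with ω h
    rw [Real.norm_eq_abs, abs_mul, abs_pow]
    exact mul_le_one₀ (pow_le_one₀ (abs_nonneg _) h) (abs_nonneg _) (hWsqb ω)
  have V := comb (fun ω => (Ystar ω - μ ω) ^ 2 * D ω)
    (fun ω => ρ ω ^ 2 * (Ystar ω - μ ω) ^ 2) (fun ω' => H ω' ^ 2)
    (hWsqm.mul hD2).stronglyMeasurable hDWi
    ((hρm.pow 2).mul hWsqm.stronglyMeasurable) hρWi (by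
      filter_upwards [hπ] with ω h
      rw [hH, h]
      rcases hR01 ω with hr | hr <;> rcases hD01 ω with hd | hd <;> rw [hr, hd] <;> ring)
  have V2 : Pr[fun ω => π ω ^ 2 * (Ystar ω - μ ω) ^ 2 | sigmaAlg X] =ᵐ[Pr]
      Pr[fun ω => ρ ω ^ 2 * (Ystar ω - μ ω) ^ 2 | sigmaAlg X] := by
    refine condExp_congr_ae ?_
    filter_upwards [hπ] with ω h
    rw [h]
  -- non-informative linkage
  have hDW : Integrable (fun ω => D ω * (Ystar ω - μ ω)) Pr :=
    hWi.bdd_mul hD.aestronglyMeasurable (Filter.Eventually.of_forall hDb)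
  have N1 : Pr[fun ω => D ω * (Ystar ω - μ ω) | (sigmaAlg fun ω => (X ω, D ω))] =ᵐ[Pr] 0 :=
    (condExp_mul_of_stronglyMeasurable_left hDXD.stronglyMeasurable hDW hWi).trans hNI
  have N2 : Pr[fun ω => D ω * (Ystar ω - μ ω) | sigmaAlg X] =ᵐ[Pr] 0 := by
    have h1 := condExp_condExp_of_le (μ := Pr) (f := fun ω => D ω * (Ystar ω - μ ω)) hmXXD hmXD0
    have h2 := condExp_congr_ae (m := sigmaAlg X) N1
    rw [condExp_zero] at h2
    exact h1.symm.trans h2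
  have hcX : Measurable[sigmaAlg X] fun ω => 1 - 2 * μ ω :=
    measurable_const.sub (measurable_const.mul hμX)
  have hvX : Measurable[sigmaAlg X] fun ω => μ ω * (1 - μ ω) :=
    hμX.mul (measurable_const.sub hμX)
  have hci : Integrable (fun ω => (1 - 2 * μ ω) * (D ω * (Ystar ω - μ ω))) Pr :=
    hDW.bdd_mul (c := 1) (hcX.mono hmX0 le_rfl).aestronglyMeasurable
      (Filter.Eventually.of_forall fun ω => by
        have := hμ0 ω
        have := hμ1 ω
        rw [Real.norm_eq_abs, abs_le]
        constructor <;> linarith)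
  have hvi : Integrable (fun ω => (μ ω * (1 - μ ω)) * D ω) Pr :=
    hDi.bdd_mul (hvX.mono hmX0 le_rfl).aestronglyMeasurable (Filter.Eventually.of_forall hvb)
  have N3 : Pr[fun ω => (1 - 2 * μ ω) * (D ω * (Ystar ω - μ ω)) | sigmaAlg X] =ᵐ[Pr]
      (fun ω => 1 - 2 * μ ω) * Pr[fun ω => D ω * (Ystar ω - μ ω) | sigmaAlg X] :=
    condExp_mul_of_stronglyMeasurable_left hcX.stronglyMeasurable hci hDW
  have N4 : Pr[fun ω => (μ ω * (1 - μ ω)) * D ω | sigmaAlg X] =ᵐ[Pr]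
      (fun ω => μ ω * (1 - μ ω)) * Pr[D | sigmaAlg X] :=
    condExp_mul_of_stronglyMeasurable_left hvX.stronglyMeasurable hvi hDi
  have N5 := condExp_add hci hvi (sigmaAlg X)
  have hdec : (fun ω => (Ystar ω - μ ω) ^ 2 * D ω) =
      (fun ω => (1 - 2 * μ ω) * (D ω * (Ystar ω - μ ω))) + fun ω => (μ ω * (1 - μ ω)) * D ω := by
    funext ω
    rw [Pi.add_apply]
    rcases hY01 ω with h | h <;> rw [h] <;> ring
  rw [← hdec] at N5
  filter_upwards [J, J1, J2, J3, V, V2, N2, N3, N4, N5] with ω j j1 j2 j3 v v2 n2 n3 n4 n5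
  rw [j, v, j1, j2, v2, n5]
  simp only [Pi.mul_apply, Pi.add_apply, n3, n4, n2, j3, hk, Pi.zero_apply]
  rw [mul_zero, zero_add, div_eq_mul_inv, ← mul_assoc p]
  ring
end
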